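/- For every ε ∈ (0, 1/100) there exists a constant K = K(ε) > 0 such that the following holds. Let X ≥ 1, X^ε ≤ H ≤ X^{2/3 − ε}, and H^{1+ε} ≤ z ≤ min{ X^{1−ε}/H^{1/2}, H^{1/2−ε} X^{1/2} }. Then | (1/X) ∫_X^{2X} | ∑_{d: d² ≤ z} μ(d) · #{ n ∈ ℤ : x/d² < n ≤ (x+H)/d² } − H ∑_{d: d² ≤ z} μ(d)/d² |² dx − 2H² ∑_{k₁,k₂: k₁² ≤ z, k₂² ≤ z} (μ(k₁)μ(k₂)/(k₁² k₂²)) ∑_{λ ≥ 1} S( Hλ / gcd(k₁², k₂²) )² | ≤ K · ( H^{−ε/2} · 2H² ∑_{k₁,k₂: k₁² ≤ z, k₂² ≤ z} (μ(k₁)μ(k₂)/(k₁² k₂²)) ∑_{λ ≥ 1} S( Hλ / gcd(k₁², k₂²) )² + H^{1/2 − ε/3} ). -/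

import Mathlib

open MeasureTheory

/-- The sinc function `S(x) = sin(πx)/(πx)`, with `S(0) = 1`. -/
noncomputable def sinc (x : ℝ) : ℝ :=
  if x = 0 then 1 else Real.sin (Real.pi * x) / (Real.pi * x)

/-- `∑_{d : d² ≤ z} μ(d) · #{n ∈ ℤ : x/d² < n ≤ (x+H)/d²}` (for `x > 0` all such `n` are
positive integers). -/
noncomputable def pairShortCount (x H z : ℝ) : ℝ :=
  ∑ d ∈ Finset.Icc 1 ⌊Real.sqrt z⌋₊,
    (ArithmeticFunction.moebius d : ℝ) *
      (Finset.Ioc ⌊x / (d : ℝ) ^ 2⌋₊ ⌊(x + H) / (d : ℝ) ^ 2⌋₊).card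

/-- `∑_{d : d² ≤ z} μ(d)/d²`. -/
noncomputable def mertensTrunc (z : ℝ) : ℝ :=
  ∑ d ∈ Finset.Icc 1 ⌊Real.sqrt z⌋₊, (ArithmeticFunction.moebius d : ℝ) / (d : ℝ) ^ 2

/-- `2H² ∑_{k₁² ≤ z, k₂² ≤ z} (μ(k₁)μ(k₂)/(k₁²k₂²)) ∑_{λ ≥ 1} S(Hλ/gcd(k₁²,k₂²))²`. -/
noncomputable def diagMain (H z : ℝ) : ℝ :=
  2 * H ^ 2 *
    ∑ k₁ ∈ Finset.Icc 1 ⌊Real.sqrt z⌋₊, ∑ k₂ ∈ Finset.Icc 1 ⌊Real.sqrt z⌋₊,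
      (ArithmeticFunction.moebius k₁ : ℝ) * (ArithmeticFunction.moebius k₂ : ℝ)
          / ((k₁ : ℝ) ^ 2 * (k₂ : ℝ) ^ 2) *
        ∑' lam : ℕ+, sinc (H * ((lam : ℕ) : ℝ) / (Nat.gcd (k₁ ^ 2) (k₂ ^ 2) : ℝ)) ^ 2

theorem sqrt_mul_abs_log_sub_log_le {A B : ℝ} (hA : 0 < A) (hB : 0 < B) :
    Real.sqrt (A * B) * |Real.log A - Real.log B| ≤ |A - B| := by
  wlog hle : B ≤ A generalizing A B
  · rw [abs_sub_comm, abs_sub_comm A B, mul_comm A B]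
    exact this hB hA (not_le.mp hle).le
  have hlog : Real.log B ≤ Real.log A := Real.log_le_log hB hle
  set x := (Real.log A - Real.log B) / 2 with hx
  have hs : x ≤ Real.sinh x := Real.self_le_sinh_iff.mpr (by linarith)
  have hsq : Real.sqrt (A * B) = Real.exp ((Real.log A + Real.log B) / 2) := by
    rw [Real.exp_half, Real.exp_add, Real.exp_log hA, Real.exp_log hB]
  have hA' : A = Real.sqrt (A * B) * Real.exp x := by
    rw [hsq, ← Real.exp_add]
    conv_lhs => rw [← Real.exp_log hA]
    congr 1; rw [hx]; ring
  have hB' : B = Real.sqrt (A * B) * Real.exp (-x) := by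
    rw [hsq, ← Real.exp_add]
    conv_lhs => rw [← Real.exp_log hB]
    congr 1; rw [hx]; ring
  have hAB : A - B = Real.sqrt (A * B) * (2 * Real.sinh x) := by
    rw [Real.sinh_eq]; linear_combination hA' - hB'
  rw [abs_of_nonneg (by linarith), abs_of_nonneg (by linarith), hAB]
  exact mul_le_mul_of_nonneg_left (by linarith) (Real.sqrt_nonneg _)

/-- A sum over points of the line spaced by at least `s`, weighted by a function of the distance
to the origin in units of `s`. -/
theorem sum_floor_abs_div_le {ι : Type*} (P : Finset ι) (u : ι → ℝ) {s : ℝ}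
    (hs : 0 < s) (hsp : ∀ i ∈ P, ∀ j ∈ P, i ≠ j → s ≤ |u i - u j|) (R : ℕ)
    (hR : ∀ i ∈ P, |u i| / s < R) (F : ℕ → ℝ) (hF : ∀ m, 0 ≤ F m) :
    ∑ i ∈ P, F ⌊|u i| / s⌋₊ ≤ 2 * ∑ m ∈ Finset.range R, F m := by
  classical
  have key : ∀ Q ⊆ P, (∀ i ∈ Q, ∀ j ∈ Q, |u i - u j| = |(|u i| - |u j|)|) →
      ∑ i ∈ Q, F ⌊|u i| / s⌋₊ ≤ ∑ m ∈ Finset.range R, F m := by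
    intro Q hQ habs
    have hinj : Set.InjOn (fun i => ⌊|u i| / s⌋₊) (Q : Set ι) := by
      intro i hi j hj hij
      by_contra hne
      have h1 := hsp i (hQ hi) j (hQ hj) hne
      rw [habs i hi j hj] at h1
      have hij' : ⌊|u i| / s⌋₊ = ⌊|u j| / s⌋₊ := hij
      have a1 := Nat.floor_le (div_nonneg (abs_nonneg (u i)) hs.le)
      have a2 := Nat.lt_floor_add_one (|u i| / s)
      have b1 := Nat.floor_le (div_nonneg (abs_nonneg (u j)) hs.le)
      have b2 := Nat.lt_floor_add_one (|u j| / s)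
      rw [hij'] at a1 a2
      have h2 : |(|u i| / s - |u j| / s)| < 1 := by
        rw [abs_lt]; constructor <;> linarith
      rw [← sub_div, abs_div, abs_of_pos hs, div_lt_one hs] at h2
      linarith
    rw [← Finset.sum_image (f := F) hinj]
    apply Finset.sum_le_sum_of_subset_of_nonneg
    · intro m hm
      obtain ⟨i, hi, rfl⟩ := Finset.mem_image.mp hm
      rw [Finset.mem_range, Nat.floor_lt (div_nonneg (abs_nonneg _) hs.le)]
      exact hR i (hQ hi)
    · intro m _ _; exact hF m
  rw [← Finset.sum_filter_add_sum_filter_not P (fun i => 0 ≤ u i), two_mul]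
  apply add_le_add
  · apply key _ (Finset.filter_subset _ _)
    intro i hi j hj
    rw [abs_of_nonneg (Finset.mem_filter.mp hi).2, abs_of_nonneg (Finset.mem_filter.mp hj).2]
  · apply key _ (Finset.filter_subset _ _)
    intro i hi j hj
    rw [abs_of_neg (not_le.mp (Finset.mem_filter.mp hi).2),
      abs_of_neg (not_le.mp (Finset.mem_filter.mp hj).2), ← abs_neg]
    congr 1; ring

theorem eq_of_gcd_eq_of_mul_eq {a b a' b' : ℕ} (h : a.gcd b = a'.gcd b') (hg : 0 < a.gcd b)
    (hm : a * b' = a' * b) : a = a' := by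
  have : a * a.gcd b = a' * a.gcd b := by
    conv_lhs => rw [h]
    rw [← Nat.gcd_mul_left, ← Nat.gcd_mul_left, hm, mul_comm a a']
  exact Nat.eq_of_mul_eq_mul_right hg this

theorem log_ratio_spacing {D g a b a' b' : ℕ} (ha : a ∈ Finset.Icc 1 D) (hb : b ∈ Finset.Icc 1 D)
    (ha' : a' ∈ Finset.Icc 1 D) (hb' : b' ∈ Finset.Icc 1 D) (h : a.gcd b = g)
    (h' : a'.gcd b' = g) (hne : (a, b) ≠ (a', b')) :
    (g : ℝ) ^ 2 / (D : ℝ) ^ 2 ≤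
      |(Real.log a - Real.log b) - (Real.log a' - Real.log b')| := by
  rw [Finset.mem_Icc] at ha hb ha' hb'
  have hg : 0 < a.gcd b := Nat.gcd_pos_of_pos_left _ ha.1
  have hmne : a * b' ≠ a' * b := by
    intro hm
    have e1 := eq_of_gcd_eq_of_mul_eq (h.trans h'.symm) hg hm
    subst e1
    exact hne (by rw [Nat.eq_of_mul_eq_mul_left ha.1 hm])
  wlog hlt : a' * b < a * b' generalizing a b a' b'
  · rw [abs_sub_comm]
    exact this ha' hb' ha hb h' h hne.symm (Nat.gcd_pos_of_pos_left _ ha'.1) hmne.symm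
      (lt_of_le_of_ne (not_lt.mp hlt) hmne)
  have d1 : g ^ 2 ∣ a * b' := by
    rw [sq]; exact mul_dvd_mul (h ▸ Nat.gcd_dvd_left a b) (h' ▸ Nat.gcd_dvd_right a' b')
  have d2 : g ^ 2 ∣ a' * b := by
    rw [sq]; exact mul_dvd_mul (h' ▸ Nat.gcd_dvd_left a' b') (h ▸ Nat.gcd_dvd_right a b)
  have h3 : g ^ 2 + a' * b ≤ a * b' := by
    have := Nat.le_of_dvd (by omega) (Nat.dvd_sub d1 d2)
    omega
  have h3r : (g : ℝ) ^ 2 + a' * b ≤ a * b' := by exact_mod_cast h3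
  have pa : (0 : ℝ) < a := by exact_mod_cast ha.1
  have pb : (0 : ℝ) < b := by exact_mod_cast hb.1
  have pa' : (0 : ℝ) < a' := by exact_mod_cast ha'.1
  have pb' : (0 : ℝ) < b' := by exact_mod_cast hb'.1
  have hlog : Real.log a - Real.log b - (Real.log a' - Real.log b')
      = Real.log (a * b' / (a' * b)) := by
    rw [Real.log_div (by positivity) (by positivity), Real.log_mul pa.ne' pb'.ne',
      Real.log_mul pa'.ne' pb.ne']
    ring
  rw [hlog]
  refine le_trans ?_ (le_abs_self _)
  refine le_trans ?_ (Real.one_sub_inv_le_log_of_pos (by positivity))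
  have e : 1 - (a * b' / (a' * b) : ℝ)⁻¹ = (a * b' - a' * b) / (a * b') := by
    field_simp
  rw [e]
  apply div_le_div₀ (by nlinarith [sq_nonneg (g : ℝ)]) (by linarith) (by positivity)
  rw [sq]
  have : (a : ℝ) ≤ D := by exact_mod_cast ha.2
  have : (b' : ℝ) ≤ D := by exact_mod_cast hb'.2
  gcongr

/-- The Fourier coefficient `(H/d²) S(nH/d²)` of the sawtooth increment. -/
noncomputable def sawCoeff (H : ℝ) (d n : ℕ) : ℝ :=
  Real.sin (Real.pi * n * H / (d : ℝ) ^ 2) / (Real.pi * n)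

theorem abs_sawCoeff_le_inv (H : ℝ) (d : ℕ) {n : ℕ} (hn : 1 ≤ n) : |sawCoeff H d n| ≤ 1 / n := by
  have hn' : (0 : ℝ) < n := by exact_mod_cast hn
  rw [sawCoeff, abs_div, abs_of_pos (mul_pos Real.pi_pos hn')]
  apply div_le_div₀ zero_le_one (Real.abs_sin_le_one _) hn'
  nlinarith [Real.pi_gt_three]

theorem abs_sawCoeff_le_div_sq {H : ℝ} (hH : 0 ≤ H) (d : ℕ) {n : ℕ} (hn : 1 ≤ n) :
    |sawCoeff H d n| ≤ H / (d : ℝ) ^ 2 := by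
  have hn' : (0 : ℝ) < n := by exact_mod_cast hn
  have hp := mul_pos Real.pi_pos hn'
  rw [sawCoeff, abs_div, abs_of_pos hp, div_le_iff₀ hp]
  refine Real.abs_sin_le_abs.trans ?_
  rw [abs_of_nonneg (by positivity)]
  exact le_of_eq (by ring)

theorem abs_sawCoeff_mul_le {H : ℝ} (hH : 0 ≤ H) {d₁ d₂ n₁ n₂ : ℕ} (hd₁ : 1 ≤ d₁) (hd₂ : 1 ≤ d₂)
    (hn₁ : 1 ≤ n₁) (hn₂ : 1 ≤ n₂) :
    |sawCoeff H d₁ n₁| * |sawCoeff H d₂ n₂| ≤ H / (d₁ * d₂ * Real.sqrt (n₁ * n₂)) := by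
  have pn₁ : (0 : ℝ) < n₁ := by exact_mod_cast hn₁
  have pn₂ : (0 : ℝ) < n₂ := by exact_mod_cast hn₂
  have pd₁ : (0 : ℝ) < d₁ := by exact_mod_cast hd₁
  have pd₂ : (0 : ℝ) < d₂ := by exact_mod_cast hd₂
  apply abs_le_of_sq_le_sq' _ (by positivity) |>.2
  have e₁ : |sawCoeff H d₁ n₁| ^ 2 ≤ 1 / n₁ * (H / (d₁ : ℝ) ^ 2) := by
    rw [sq]
    exact mul_le_mul (abs_sawCoeff_le_inv H d₁ hn₁) (abs_sawCoeff_le_div_sq hH d₁ hn₁)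
      (abs_nonneg _) (by positivity)
  have e₂ : |sawCoeff H d₂ n₂| ^ 2 ≤ 1 / n₂ * (H / (d₂ : ℝ) ^ 2) := by
    rw [sq]
    exact mul_le_mul (abs_sawCoeff_le_inv H d₂ hn₂) (abs_sawCoeff_le_div_sq hH d₂ hn₂)
      (abs_nonneg _) (by positivity)
  rw [mul_pow]
  refine (mul_le_mul e₁ e₂ (sq_nonneg _) (by positivity)).trans (le_of_eq ?_)
  rw [div_pow, mul_pow, Real.sq_sqrt (by positivity)]
  field_simp

/-- The bound for the mean of an oscillation of frequency `α` over an interval of length `X`;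
it vanishes at `α = 0`. -/
noncomputable def oscBound (X α : ℝ) : ℝ := min 1 (1 / (X * |α|))

theorem oscBound_nonneg {X : ℝ} (hX : 0 ≤ X) (α : ℝ) : 0 ≤ oscBound X α :=
  le_min zero_le_one (by positivity)

/-- Bound for a pair of frequencies in terms of its normalised logarithmic distance `m`. -/
noncomputable def pairWeight (X H : ℝ) (D g m : ℕ) : ℝ :=
  if m = 0 then (D : ℝ) ^ 2 / (Real.sqrt X * g) else H * (D : ℝ) ^ 2 / (X * (g : ℝ) ^ 2 * m)

theorem pairWeight_nonneg {X H : ℝ} (hX : 0 ≤ X) (hH : 0 ≤ H) (D g m : ℕ) :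
    0 ≤ pairWeight X H D g m := by
  unfold pairWeight; split_ifs <;> positivity

theorem pair_term_le {X H : ℝ} (hX : 0 < X) (hH : 0 ≤ H) {D d₁ d₂ n₁ n₂ : ℕ}
    (hd₁ : d₁ ∈ Finset.Icc 1 D) (hd₂ : d₂ ∈ Finset.Icc 1 D) (hn₁ : 1 ≤ n₁) (hn₂ : 1 ≤ n₂) :
    |sawCoeff H d₁ n₁| * |sawCoeff H d₂ n₂| *
        oscBound X ((n₁ : ℝ) / (d₁ : ℝ) ^ 2 - (n₂ : ℝ) / (d₂ : ℝ) ^ 2) ≤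
      1 / (n₁ * n₂) * pairWeight X H D (d₁.gcd d₂)
        ⌊|(Real.log d₁ - Real.log d₂) - (Real.log n₁ - Real.log n₂) / 2| /
          (((d₁.gcd d₂ : ℕ) : ℝ) ^ 2 / (D : ℝ) ^ 2)⌋₊ := by
  rw [Finset.mem_Icc] at hd₁ hd₂
  have pn₁ : (0 : ℝ) < n₁ := by exact_mod_cast hn₁
  have pn₂ : (0 : ℝ) < n₂ := by exact_mod_cast hn₂
  have pd₁ : (0 : ℝ) < d₁ := by exact_mod_cast hd₁.1
  have pd₂ : (0 : ℝ) < d₂ := by exact_mod_cast hd₂.1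
  have le₁ : (d₁ : ℝ) ≤ D := by exact_mod_cast hd₁.2
  have le₂ : (d₂ : ℝ) ≤ D := by exact_mod_cast hd₂.2
  have pD : (0 : ℝ) < D := pd₁.trans_le le₁
  have hgpos : 0 < d₁.gcd d₂ := Nat.gcd_pos_of_pos_left _ hd₁.1
  set g := d₁.gcd d₂ with hg
  have pg : (0 : ℝ) < g := by exact_mod_cast hgpos
  set u := (Real.log d₁ - Real.log d₂) - (Real.log n₁ - Real.log n₂) / 2 with hu
  set m := ⌊|u| / ((g : ℝ) ^ 2 / (D : ℝ) ^ 2)⌋₊ with hm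
  set α := (n₁ : ℝ) / (d₁ : ℝ) ^ 2 - (n₂ : ℝ) / (d₂ : ℝ) ^ 2 with hα
  by_cases hα0 : α = 0
  · have : oscBound X α = 0 := by simp [oscBound, hα0]
    rw [this, mul_zero]
    exact mul_nonneg (by positivity) (pairWeight_nonneg hX.le hH _ _ _)
  have pα : 0 < |α| := abs_pos.mpr hα0
  by_cases hm0 : m = 0
  · rw [pairWeight, if_pos hm0]
    have hK : oscBound X α ≤ (D : ℝ) ^ 2 / (Real.sqrt X * g) := by
      have hint : (g : ℝ) ^ 2 ≤ |(n₁ : ℝ) * d₂ ^ 2 - n₂ * d₁ ^ 2| := by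
        have hdvd : ((g : ℤ) ^ 2) ∣ (n₁ : ℤ) * d₂ ^ 2 - n₂ * d₁ ^ 2 := by
          apply dvd_sub <;> apply Dvd.dvd.mul_left <;> apply pow_dvd_pow_of_dvd
          · exact_mod_cast Nat.gcd_dvd_right d₁ d₂
          · exact_mod_cast Nat.gcd_dvd_left d₁ d₂
        have hne : (n₁ : ℤ) * d₂ ^ 2 - n₂ * d₁ ^ 2 ≠ 0 := by
          intro h0
          apply hα0
          have h0r : (n₁ : ℝ) * d₂ ^ 2 - n₂ * d₁ ^ 2 = 0 := by exact_mod_cast h0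
          rw [hα, div_sub_div _ _ (by positivity) (by positivity)]
          rw [div_eq_zero_iff]; left; linarith
        have := Int.le_of_dvd (abs_pos.mpr hne) ((dvd_abs _ _).mpr hdvd)
        exact_mod_cast this
      have hαlow : (g : ℝ) ^ 2 / ((D : ℝ) ^ 2) ^ 2 ≤ |α| := by
        have : α = ((n₁ : ℝ) * d₂ ^ 2 - n₂ * d₁ ^ 2) / ((d₁ : ℝ) ^ 2 * d₂ ^ 2) := by
          rw [hα, div_sub_div _ _ (by positivity) (by positivity)]; ring
        rw [this, abs_div, abs_of_pos (a := (d₁ : ℝ) ^ 2 * d₂ ^ 2) (by positivity)]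
        apply div_le_div₀ (abs_nonneg _) hint (by positivity)
        rw [sq ((D : ℝ) ^ 2)]
        gcongr
      set y := (D : ℝ) ^ 2 / (Real.sqrt X * g) with hy
      have py : 0 < y := by positivity
      have hy2 : 1 / (X * |α|) ≤ y ^ 2 := by
        rw [hy, div_pow, mul_pow, Real.sq_sqrt hX.le, div_le_div_iff₀ (by positivity)
          (by positivity)]
        rw [div_le_iff₀ (by positivity)] at hαlow
        nlinarith
      unfold oscBound
      by_cases h1 : y ≤ 1
      · exact (min_le_right _ _).trans (hy2.trans (by nlinarith))
      · exact (min_le_left _ _).trans (not_le.mp h1).le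
    apply mul_le_mul _ hK (oscBound_nonneg hX.le _) (by positivity)
    calc |sawCoeff H d₁ n₁| * |sawCoeff H d₂ n₂| ≤ 1 / n₁ * (1 / n₂) :=
          mul_le_mul (abs_sawCoeff_le_inv H d₁ hn₁) (abs_sawCoeff_le_inv H d₂ hn₂)
            (abs_nonneg _) (by positivity)
      _ = 1 / (n₁ * n₂) := by field_simp
  · rw [pairWeight, if_neg hm0]
    have pm : (0 : ℝ) < m := by exact_mod_cast Nat.pos_of_ne_zero hm0
    have hmu : (m : ℝ) * ((g : ℝ) ^ 2 / (D : ℝ) ^ 2) ≤ |u| := by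
      rw [← le_div_iff₀ (by positivity)]
      exact Nat.floor_le (by positivity)
    have hlow : Real.sqrt (n₁ * n₂) / (d₁ * d₂) * (2 * |u|) ≤ |α| := by
      have h := sqrt_mul_abs_log_sub_log_le (A := (n₁ : ℝ) / (d₁ : ℝ) ^ 2)
        (B := (n₂ : ℝ) / (d₂ : ℝ) ^ 2) (by positivity) (by positivity)
      have e1 : Real.sqrt ((n₁ : ℝ) / (d₁ : ℝ) ^ 2 * ((n₂ : ℝ) / (d₂ : ℝ) ^ 2))
          = Real.sqrt (n₁ * n₂) / (d₁ * d₂) := by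
        rw [div_mul_div_comm, Real.sqrt_div (by positivity), ← mul_pow,
          Real.sqrt_sq (by positivity)]
      have e2 : |Real.log ((n₁ : ℝ) / (d₁ : ℝ) ^ 2) - Real.log ((n₂ : ℝ) / (d₂ : ℝ) ^ 2)|
          = 2 * |u| := by
        rw [Real.log_div (by positivity) (by positivity), Real.log_div (by positivity)
          (by positivity), Real.log_pow, Real.log_pow, ← abs_neg]
        have e3 : 2 * |u| = |2 * u| := by rw [abs_mul, abs_two]
        rw [e3, hu]
        congr 1
        push_cast; ring
      rwa [e1, e2] at h
    have pu : 0 < |u| := lt_of_lt_of_le (by positivity) hmu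
    have ps : 0 < Real.sqrt ((n₁ : ℝ) * n₂) := Real.sqrt_pos.mpr (by positivity)
    have hK : oscBound X α ≤ 1 / (X * (Real.sqrt (n₁ * n₂) / (d₁ * d₂) * |u|)) := by
      refine (min_le_right _ _).trans ?_
      apply one_div_le_one_div_of_le (by positivity)
      apply mul_le_mul_of_nonneg_left _ hX.le
      refine le_trans ?_ hlow
      apply mul_le_mul_of_nonneg_left _ (by positivity)
      linarith
    calc |sawCoeff H d₁ n₁| * |sawCoeff H d₂ n₂| * oscBound X α
        ≤ H / (d₁ * d₂ * Real.sqrt (n₁ * n₂)) *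
            (1 / (X * (Real.sqrt (n₁ * n₂) / (d₁ * d₂) * |u|))) :=
          mul_le_mul (abs_sawCoeff_mul_le hH hd₁.1 hd₂.1 hn₁ hn₂) hK
            (oscBound_nonneg hX.le _) (by positivity)
      _ = H / (X * (Real.sqrt (n₁ * n₂)) ^ 2 * |u|) := by field_simp
      _ = 1 / (n₁ * n₂) * (H / (X * |u|)) := by
          rw [Real.sq_sqrt (by positivity)]; field_simp
      _ ≤ 1 / (n₁ * n₂) * (H / (X * (m * ((g : ℝ) ^ 2 / (D : ℝ) ^ 2)))) := by
          gcongr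
      _ = _ := by field_simp

theorem sum_inv_Icc_le (N : ℕ) : ∑ n ∈ Finset.Icc 1 N, (1 : ℝ) / n ≤ 1 + Real.log N := by
  have h := harmonic_le_one_add_log N
  rw [harmonic_eq_sum_Icc] at h
  push_cast at h
  simpa [one_div] using h

theorem sum_pairWeight_le {X H : ℝ} (hX : 0 < X) (hH : 0 ≤ H) (D : ℕ) {g : ℕ} (hg : 1 ≤ g)
    (R : ℕ) :
    ∑ m ∈ Finset.range (R + 1), pairWeight X H D g m ≤
      1 / g * ((D : ℝ) ^ 2 / Real.sqrt X + H * (D : ℝ) ^ 2 / X * (1 + Real.log R)) := by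
  have pg : (1 : ℝ) ≤ g := by exact_mod_cast hg
  rw [Finset.sum_range_succ']
  have h1 : ∑ k ∈ Finset.range R, pairWeight X H D g (k + 1)
      = H * (D : ℝ) ^ 2 / (X * (g : ℝ) ^ 2) * ∑ n ∈ Finset.Icc 1 R, (1 : ℝ) / n := by
    rw [Finset.mul_sum, Finset.range_eq_Ico,
      Finset.sum_Ico_add' (fun k => pairWeight X H D g k) 0 R 1]
    apply Finset.sum_congr
    · ext; simp [Finset.mem_Ico, Finset.mem_Icc]
    · intro k hk
      have hk1 : k ≠ 0 := by
        have := (Finset.mem_Icc.mp hk).1; omega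
      have : (k : ℝ) ≠ 0 := by exact_mod_cast hk1
      rw [pairWeight, if_neg hk1]; field_simp
  rw [h1, pairWeight, if_pos rfl]
  have hlog : 0 ≤ 1 + Real.log R :=
    (Finset.sum_nonneg fun _ _ => by positivity).trans (sum_inv_Icc_le R)
  have h2 : H * (D : ℝ) ^ 2 / (X * (g : ℝ) ^ 2) ≤ 1 / g * (H * (D : ℝ) ^ 2 / X) := by
    rw [div_mul_div_comm, one_mul]
    apply div_le_div_of_nonneg_left (by positivity) (by positivity)
    have : (g : ℝ) ≤ (g : ℝ) ^ 2 := by nlinarith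
    nlinarith [mul_le_mul_of_nonneg_left this hX.le]
  calc _ ≤ 1 / g * (H * (D : ℝ) ^ 2 / X) * (1 + Real.log R)
        + (D : ℝ) ^ 2 / (Real.sqrt X * g) := by
        gcongr
        exact sum_inv_Icc_le R
    _ = _ := by
        have : 0 < Real.sqrt X := Real.sqrt_pos.mpr hX
        field_simp
        ring

theorem sum_pairs_le {X H : ℝ} (hX : 0 < X) (hH : 0 ≤ H) {D N n₁ n₂ : ℕ} (hDN : D ≤ N)
    (hn₁ : n₁ ∈ Finset.Icc 1 N) (hn₂ : n₂ ∈ Finset.Icc 1 N) :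
    ∑ p ∈ Finset.Icc 1 D ×ˢ Finset.Icc 1 D, |sawCoeff H p.1 n₁| * |sawCoeff H p.2 n₂| *
        oscBound X ((n₁ : ℝ) / (p.1 : ℝ) ^ 2 - (n₂ : ℝ) / (p.2 : ℝ) ^ 2) ≤
      1 / (n₁ * n₂) * (2 * ((1 + Real.log N) * ((D : ℝ) ^ 2 / Real.sqrt X +
        H * (D : ℝ) ^ 2 / X * (1 + Real.log ((2 * N ^ 3 : ℕ) : ℝ))))) := by
  have hmaps : ∀ p ∈ Finset.Icc 1 D ×ˢ Finset.Icc 1 D, p.1.gcd p.2 ∈ Finset.Icc 1 D := by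
    intro p hp
    obtain ⟨h1, h2⟩ := Finset.mem_product.mp hp
    rw [Finset.mem_Icc] at h1 h2 ⊢
    exact ⟨Nat.gcd_pos_of_pos_left _ h1.1, (Nat.gcd_le_left _ h1.1).trans h1.2⟩
  rw [← Finset.sum_fiberwise_of_maps_to hmaps]
  have hn₁' := Finset.mem_Icc.mp hn₁
  have hn₂' := Finset.mem_Icc.mp hn₂
  set B := (D : ℝ) ^ 2 / Real.sqrt X +
        H * (D : ℝ) ^ 2 / X * (1 + Real.log ((2 * N ^ 3 : ℕ) : ℝ)) with hB
  have hlogbd : ∀ k ∈ Finset.Icc 1 N, 0 ≤ Real.log k ∧ Real.log k < N := by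
    intro k hk
    rw [Finset.mem_Icc] at hk
    have hk1 : (1 : ℝ) ≤ k := by exact_mod_cast hk.1
    have hkN : (k : ℝ) ≤ N := by exact_mod_cast hk.2
    refine ⟨Real.log_nonneg hk1, ?_⟩
    have := Real.log_le_sub_one_of_pos (by linarith : (0 : ℝ) < k)
    linarith
  have hNpos : 1 ≤ N := hn₁'.1.trans hn₁'.2
  have hper : ∀ g ∈ Finset.Icc 1 D,
      ∑ p ∈ Finset.Icc 1 D ×ˢ Finset.Icc 1 D with p.1.gcd p.2 = g,
        |sawCoeff H p.1 n₁| * |sawCoeff H p.2 n₂| *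
        oscBound X ((n₁ : ℝ) / (p.1 : ℝ) ^ 2 - (n₂ : ℝ) / (p.2 : ℝ) ^ 2)
      ≤ 1 / (n₁ * n₂) * (2 * (1 / g * B)) := by
    intro g hg
    have hg' := Finset.mem_Icc.mp hg
    have pg : (1 : ℝ) ≤ g := by exact_mod_cast hg'.1
    have pD : (1 : ℝ) ≤ D := by exact_mod_cast hg'.1.trans hg'.2
    have hDN' : (D : ℝ) ≤ N := by exact_mod_cast hDN
    calc _ ≤ ∑ p ∈ Finset.Icc 1 D ×ˢ Finset.Icc 1 D with p.1.gcd p.2 = g,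
          1 / ((n₁ : ℝ) * n₂) * pairWeight X H D g
            ⌊|(Real.log p.1 - Real.log p.2) - (Real.log n₁ - Real.log n₂) / 2| /
              ((g : ℝ) ^ 2 / (D : ℝ) ^ 2)⌋₊ := by
          apply Finset.sum_le_sum
          intro p hp
          obtain ⟨hp1, hp2⟩ := Finset.mem_filter.mp hp
          obtain ⟨h1, h2⟩ := Finset.mem_product.mp hp1
          have := pair_term_le hX hH h1 h2 hn₁'.1 hn₂'.1
          rwa [hp2] at this
      _ ≤ 1 / ((n₁ : ℝ) * n₂) * (2 * ∑ m ∈ Finset.range (2 * N ^ 3 + 1),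
            pairWeight X H D g m) := by
          rw [← Finset.mul_sum]
          apply mul_le_mul_of_nonneg_left _ (by positivity)
          apply sum_floor_abs_div_le
            (u := fun p : ℕ × ℕ => (Real.log p.1 - Real.log p.2)
              - (Real.log n₁ - Real.log n₂) / 2) (F := pairWeight X H D g)
          · positivity
          · intro p hp q hq hpq
            obtain ⟨hp1, hp2⟩ := Finset.mem_filter.mp hp
            obtain ⟨h1, h2⟩ := Finset.mem_product.mp hp1
            obtain ⟨hq1, hq2⟩ := Finset.mem_filter.mp hq
            obtain ⟨h3, h4⟩ := Finset.mem_product.mp hq1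
            have := log_ratio_spacing h1 h2 h3 h4 hp2 hq2 hpq
            refine this.trans (le_of_eq ?_)
            congr 1; ring
          · intro p hp
            obtain ⟨hp1, hp2⟩ := Finset.mem_filter.mp hp
            obtain ⟨h1, h2⟩ := Finset.mem_product.mp hp1
            have hsub : ∀ k ∈ Finset.Icc 1 D, k ∈ Finset.Icc 1 N := fun k hk =>
              Finset.Icc_subset_Icc_right hDN hk
            obtain ⟨a1, a2⟩ := hlogbd _ (hsub _ h1)
            obtain ⟨b1, b2⟩ := hlogbd _ (hsub _ h2)
            obtain ⟨c1, c2⟩ := hlogbd _ hn₁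
            obtain ⟨e1, e2⟩ := hlogbd _ hn₂
            have hu : |(Real.log p.1 - Real.log p.2) - (Real.log n₁ - Real.log n₂) / 2|
                ≤ 2 * N := by
              rw [abs_le]; constructor <;> linarith
            rw [div_lt_iff₀ (by positivity)]
            refine lt_of_le_of_lt hu ?_
            rw [mul_div_assoc', lt_div_iff₀ (by positivity)]
            push_cast
            have : (D : ℝ) ^ 2 ≤ (N : ℝ) ^ 2 := by gcongr
            have hN0 : (1 : ℝ) ≤ N := by exact_mod_cast hNpos
            have hg2 : (1 : ℝ) ≤ (g : ℝ) ^ 2 := by nlinarith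
            calc 2 * (N : ℝ) * (D : ℝ) ^ 2 ≤ 2 * N * N ^ 2 := by gcongr
              _ < 2 * (N : ℝ) ^ 3 + 1 := by nlinarith
              _ ≤ (2 * (N : ℝ) ^ 3 + 1) * (g : ℝ) ^ 2 := by
                  apply le_mul_of_one_le_right _ hg2; positivity
          · intro m; exact pairWeight_nonneg hX.le hH _ _ _
      _ ≤ _ := by
          gcongr
          exact sum_pairWeight_le hX hH D hg'.1 _
  refine (Finset.sum_le_sum hper).trans ?_
  rw [← Finset.mul_sum, ← Finset.mul_sum, ← Finset.sum_mul]
  have hBnn : 0 ≤ B := by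
    have : 0 ≤ Real.log ((2 * N ^ 3 : ℕ) : ℝ) := Real.log_natCast_nonneg _
    positivity
  have hlogD : ∑ g ∈ Finset.Icc 1 D, (1 : ℝ) / g ≤ 1 + Real.log N := by
    refine le_trans (Finset.sum_le_sum_of_subset_of_nonneg (Finset.Icc_subset_Icc_right hDN)
      fun _ _ _ => by positivity) (sum_inv_Icc_le N)
  gcongr

theorem sum_mul_sum_inv_le (N : ℕ) :
    ∑ n₁ ∈ Finset.Icc 1 N, ∑ n₂ ∈ Finset.Icc 1 N, (1 : ℝ) / (n₁ * n₂) ≤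
      (1 + Real.log N) ^ 2 := by
  have h0 : (0 : ℝ) ≤ ∑ n ∈ Finset.Icc 1 N, (1 : ℝ) / n :=
    Finset.sum_nonneg fun _ _ => by positivity
  have e : ∑ n₁ ∈ Finset.Icc 1 N, ∑ n₂ ∈ Finset.Icc 1 N, (1 : ℝ) / (n₁ * n₂)
      = (∑ n ∈ Finset.Icc 1 N, (1 : ℝ) / n) ^ 2 := by
    rw [sq, Finset.sum_mul_sum]
    exact Finset.sum_congr rfl fun _ _ => Finset.sum_congr rfl fun _ _ => by
      rw [one_div_mul_one_div]
  rw [e]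
  exact pow_le_pow_left₀ h0 (sum_inv_Icc_le N) 2

/-- The frequency `n/d²` attached to the pair `(d, n)`. -/
noncomputable def freq (p : ℕ × ℕ) : ℝ := (p.2 : ℝ) / (p.1 : ℝ) ^ 2

theorem sum_quadruple (D N : ℕ) (T : ℕ × ℕ → ℕ × ℕ → ℝ) :
    ∑ p ∈ Finset.Icc 1 D ×ˢ Finset.Icc 1 N, ∑ q ∈ Finset.Icc 1 D ×ˢ Finset.Icc 1 N, T p q =
      ∑ n₁ ∈ Finset.Icc 1 N, ∑ n₂ ∈ Finset.Icc 1 N,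
        ∑ d ∈ Finset.Icc 1 D ×ˢ Finset.Icc 1 D, T (d.1, n₁) (d.2, n₂) := by
  simp only [Finset.sum_product]
  rw [Finset.sum_comm]
  apply Finset.sum_congr rfl; intro n₁ _
  rw [Finset.sum_comm]
  simp only [Finset.sum_comm (s := Finset.Icc 1 N) (t := Finset.Icc 1 D)]
  rw [Finset.sum_comm]

theorem sum_oscBound_sub_le {X H : ℝ} (hX : 0 < X) (hH : 0 ≤ H) {D N : ℕ} (hDN : D ≤ N) :
    ∑ p ∈ Finset.Icc 1 D ×ˢ Finset.Icc 1 N, ∑ q ∈ Finset.Icc 1 D ×ˢ Finset.Icc 1 N,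
        |sawCoeff H p.1 p.2| * |sawCoeff H q.1 q.2| * oscBound X (freq p - freq q) ≤
      (1 + Real.log N) ^ 2 * (2 * ((1 + Real.log N) * ((D : ℝ) ^ 2 / Real.sqrt X +
        H * (D : ℝ) ^ 2 / X * (1 + Real.log ((2 * N ^ 3 : ℕ) : ℝ))))) := by
  rw [sum_quadruple]
  set B := 2 * ((1 + Real.log N) * ((D : ℝ) ^ 2 / Real.sqrt X +
        H * (D : ℝ) ^ 2 / X * (1 + Real.log ((2 * N ^ 3 : ℕ) : ℝ)))) with hB
  have hBnn : 0 ≤ B := by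
    have : 0 ≤ Real.log ((2 * N ^ 3 : ℕ) : ℝ) := Real.log_natCast_nonneg _
    have : 0 ≤ Real.log (N : ℝ) := Real.log_natCast_nonneg _
    positivity
  calc _ ≤ ∑ n₁ ∈ Finset.Icc 1 N, ∑ n₂ ∈ Finset.Icc 1 N, 1 / ((n₁ : ℝ) * n₂) * B :=
        Finset.sum_le_sum fun n₁ h₁ => Finset.sum_le_sum fun n₂ h₂ =>
          sum_pairs_le hX hH hDN h₁ h₂
    _ = (∑ n₁ ∈ Finset.Icc 1 N, ∑ n₂ ∈ Finset.Icc 1 N, 1 / ((n₁ : ℝ) * n₂)) * B := by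
        simp only [Finset.sum_mul]
    _ ≤ _ := mul_le_mul_of_nonneg_right (sum_mul_sum_inv_le N) hBnn

theorem sum_inv_freq_add_le {X H : ℝ} (hX : 0 < X) (hH : 0 ≤ H) (D N : ℕ) :
    ∑ p ∈ Finset.Icc 1 D ×ˢ Finset.Icc 1 N, ∑ q ∈ Finset.Icc 1 D ×ˢ Finset.Icc 1 N,
        |sawCoeff H p.1 p.2| * |sawCoeff H q.1 q.2| * (1 / (X * (freq p + freq q))) ≤
      (1 + Real.log N) ^ 2 * (H * (D : ℝ) ^ 2 / X) := by
  rw [sum_quadruple]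
  calc _ ≤ ∑ n₁ ∈ Finset.Icc 1 N, ∑ n₂ ∈ Finset.Icc 1 N,
        ∑ d ∈ Finset.Icc 1 D ×ˢ Finset.Icc 1 D, 1 / ((n₁ : ℝ) * n₂) * (H / X) := by
        apply Finset.sum_le_sum; intro n₁ hn₁
        apply Finset.sum_le_sum; intro n₂ hn₂
        apply Finset.sum_le_sum; intro d hd
        obtain ⟨h₁, h₂⟩ := Finset.mem_product.mp hd
        rw [Finset.mem_Icc] at h₁ h₂ hn₁ hn₂
        have pn₁ : (0 : ℝ) < n₁ := by exact_mod_cast hn₁.1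
        have pn₂ : (0 : ℝ) < n₂ := by exact_mod_cast hn₂.1
        have pd₁ : (0 : ℝ) < d.1 := by exact_mod_cast h₁.1
        have pd₂ : (0 : ℝ) < d.2 := by exact_mod_cast h₂.1
        have ps : 0 < Real.sqrt ((n₁ : ℝ) * n₂) := Real.sqrt_pos.mpr (by positivity)
        have hamgm : Real.sqrt (n₁ * n₂) / (d.1 * d.2) ≤
            (n₁ : ℝ) / (d.1 : ℝ) ^ 2 + (n₂ : ℝ) / (d.2 : ℝ) ^ 2 := by
          have e : Real.sqrt (n₁ * n₂) / (d.1 * d.2)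
              = (Real.sqrt n₁ / d.1) * (Real.sqrt n₂ / d.2) := by
            rw [Real.sqrt_mul pn₁.le, div_mul_div_comm]
          have e₁ : (n₁ : ℝ) / (d.1 : ℝ) ^ 2 = (Real.sqrt n₁ / d.1) ^ 2 := by
            rw [div_pow, Real.sq_sqrt pn₁.le]
          have e₂ : (n₂ : ℝ) / (d.2 : ℝ) ^ 2 = (Real.sqrt n₂ / d.2) ^ 2 := by
            rw [div_pow, Real.sq_sqrt pn₂.le]
          rw [e, e₁, e₂]
          nlinarith [sq_nonneg (Real.sqrt n₁ / d.1 - Real.sqrt n₂ / d.2),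
            sq_nonneg (Real.sqrt n₁ / d.1), sq_nonneg (Real.sqrt n₂ / d.2)]
        have hw := abs_sawCoeff_mul_le hH h₁.1 h₂.1 hn₁.1 hn₂.1
        calc _ ≤ H / (d.1 * d.2 * Real.sqrt (n₁ * n₂)) *
              (1 / (X * (Real.sqrt (n₁ * n₂) / (d.1 * d.2)))) := by
              apply mul_le_mul hw _ _ (by positivity)
              · apply one_div_le_one_div_of_le (by positivity)
                exact mul_le_mul_of_nonneg_left hamgm hX.le
              · unfold freq; positivity
          _ = H / (X * Real.sqrt (n₁ * n₂) ^ 2) := by field_simp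
          _ = _ := by rw [Real.sq_sqrt (by positivity)]; field_simp
    _ = (∑ n₁ ∈ Finset.Icc 1 N, ∑ n₂ ∈ Finset.Icc 1 N, 1 / ((n₁ : ℝ) * n₂)) *
          (H * (D : ℝ) ^ 2 / X) := by
        simp only [Finset.sum_const, Finset.card_product, Nat.card_Icc, Finset.sum_mul]
        refine Finset.sum_congr rfl fun _ _ => Finset.sum_congr rfl fun _ _ => ?_
        simp only [nsmul_eq_mul]; push_cast; simp; ring
    _ ≤ _ := mul_le_mul_of_nonneg_right (sum_mul_sum_inv_le N) (by positivity)

theorem abs_integral_cos_le {β : ℝ} (hβ : β ≠ 0) (a b c : ℝ) :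
    |∫ x in a..b, Real.cos (2 * Real.pi * β * (x + c))| ≤ 1 / |β| := by
  have hne : 2 * Real.pi * β ≠ 0 := by have := Real.pi_pos; positivity
  have e : ∀ x, 2 * Real.pi * β * (x + c) = 2 * Real.pi * β * x + 2 * Real.pi * β * c :=
    fun x => by ring
  simp only [e]
  rw [intervalIntegral.integral_comp_mul_add (fun x => Real.cos x) hne, integral_cos, smul_eq_mul,
    abs_mul, abs_inv, abs_mul, abs_of_pos (mul_pos two_pos Real.pi_pos)]
  have h1 : ∀ s t : ℝ, |Real.sin s - Real.sin t| ≤ 2 := fun s t => by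
    rw [abs_le]
    constructor <;> linarith [Real.sin_le_one s, Real.neg_one_le_sin s, Real.sin_le_one t,
      Real.neg_one_le_sin t]
  have hb : 0 < |β| := abs_pos.mpr hβ
  calc _ ≤ (2 * Real.pi * |β|)⁻¹ * 2 := by
        gcongr
        exact h1 _ _
    _ = 1 / (Real.pi * |β|) := by field_simp
    _ ≤ 1 / |β| := by
        apply one_div_le_one_div_of_le hb
        nlinarith [Real.pi_gt_three]

theorem abs_mean_cos_le {X : ℝ} (hX : 0 < X) (β c : ℝ) :
    |1 / X * (∫ x in X..(2 * X), Real.cos (2 * Real.pi * β * (x + c))) -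
      (if β = 0 then 1 else 0)| ≤ oscBound X β := by
  split_ifs with hβ
  · have : (∫ x in X..(2 * X), Real.cos (2 * Real.pi * β * (x + c))) = X := by
      simp [hβ]; ring
    rw [this, one_div_mul_cancel hX.ne', sub_self, abs_zero]
    exact oscBound_nonneg hX.le _
  · rw [sub_zero, abs_mul, abs_of_pos (one_div_pos.mpr hX)]
    apply le_min
    · have h := intervalIntegral.norm_integral_le_of_norm_le_const (a := X) (b := 2 * X) (C := 1)
        (f := fun x => Real.cos (2 * Real.pi * β * (x + c)))
        (fun x _ => Real.abs_cos_le_one _)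
      rw [Real.norm_eq_abs] at h
      have e : |2 * X - X| = X := by rw [abs_of_pos] <;> linarith
      rw [e, one_mul] at h
      rw [one_div, inv_mul_le_iff₀ hX]; linarith
    · rw [← one_div_mul_one_div]
      exact mul_le_mul_of_nonneg_left (abs_integral_cos_le hβ _ _ _) (by positivity)

theorem abs_mean_sq_sub_diag_le {ι : Type*} (P : Finset ι) (a v : ι → ℝ) {X : ℝ} (hX : 0 < X)
    (hv : ∀ i ∈ P, 0 < v i) (c : ℝ) :
    |1 / X * (∫ x in X..(2 * X), (∑ i ∈ P, a i * Real.cos (2 * Real.pi * v i * (x + c))) ^ 2) -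
        1 / 2 * ∑ i ∈ P, ∑ j ∈ P, if v i = v j then a i * a j else 0| ≤
      1 / 2 * (∑ i ∈ P, ∑ j ∈ P, |a i| * |a j| * oscBound X (v i - v j) +
        ∑ i ∈ P, ∑ j ∈ P, |a i| * |a j| * (1 / (X * (v i + v j)))) := by
  set I : ℝ → ℝ := fun β =>
    1 / X * ∫ x in X..(2 * X), Real.cos (2 * Real.pi * β * (x + c)) with hI
  have hexp : 1 / X * (∫ x in X..(2 * X),
        (∑ i ∈ P, a i * Real.cos (2 * Real.pi * v i * (x + c))) ^ 2)
      = ∑ i ∈ P, ∑ j ∈ P, a i * a j * (1 / 2) * (I (v i - v j) + I (v i + v j)) := by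
    have hpt : ∀ x, (∑ i ∈ P, a i * Real.cos (2 * Real.pi * v i * (x + c))) ^ 2
        = ∑ i ∈ P, ∑ j ∈ P, a i * a j * (1 / 2) *
          (Real.cos (2 * Real.pi * (v i - v j) * (x + c)) +
            Real.cos (2 * Real.pi * (v i + v j) * (x + c))) := by
      intro x
      rw [sq, Finset.sum_mul_sum]
      refine Finset.sum_congr rfl fun i _ => Finset.sum_congr rfl fun j _ => ?_
      have e1 : 2 * Real.pi * (v i - v j) * (x + c)
        = 2 * Real.pi * v i * (x + c) - 2 * Real.pi * v j * (x + c) := by ring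
      have e2 : 2 * Real.pi * (v i + v j) * (x + c)
        = 2 * Real.pi * v i * (x + c) + 2 * Real.pi * v j * (x + c) := by ring
      rw [e1, e2, Real.cos_sub, Real.cos_add]; ring
    have hint : ∀ f : ℝ → ℝ, Continuous f → IntervalIntegrable f volume X (2 * X) :=
      fun f hf => hf.intervalIntegrable _ _
    simp only [hpt]
    rw [intervalIntegral.integral_finsetSum fun i _ => hint _ (by fun_prop), Finset.mul_sum]
    refine Finset.sum_congr rfl fun i _ => ?_
    rw [intervalIntegral.integral_finsetSum fun j _ => hint _ (by fun_prop), Finset.mul_sum]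
    refine Finset.sum_congr rfl fun j _ => ?_
    rw [intervalIntegral.integral_const_mul, intervalIntegral.integral_add
      (hint _ (by fun_prop)) (hint _ (by fun_prop)), hI]
    ring
  rw [hexp, Finset.mul_sum, ← Finset.sum_sub_distrib, ← Finset.sum_add_distrib, Finset.mul_sum]
  refine (Finset.abs_sum_le_sum_abs _ _).trans (Finset.sum_le_sum fun i hi => ?_)
  rw [Finset.mul_sum, ← Finset.sum_sub_distrib, ← Finset.sum_add_distrib, Finset.mul_sum]
  refine (Finset.abs_sum_le_sum_abs _ _).trans (Finset.sum_le_sum fun j hj => ?_)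
  have h1 := abs_mean_cos_le hX (v i - v j) c
  have hpos : 0 < v i + v j := add_pos (hv i hi) (hv j hj)
  have h2 := (abs_mean_cos_le hX (v i + v j) c).trans (min_le_right _ _)
  rw [if_neg hpos.ne', sub_zero, abs_of_pos hpos] at h2
  have e : a i * a j * (1 / 2) * (I (v i - v j) + I (v i + v j)) -
      1 / 2 * (if v i = v j then a i * a j else 0)
      = 1 / 2 * ((a i * a j) * ((I (v i - v j) - if v i - v j = 0 then 1 else 0)
        + I (v i + v j))) := by
    simp only [sub_eq_zero]
    split_ifs <;> ring
  rw [e, abs_mul, abs_of_pos (by norm_num : (0 : ℝ) < 1 / 2), abs_mul, abs_mul, ← mul_add]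
  gcongr
  exact (abs_add_le _ _).trans (add_le_add h1 h2)

/-- Partial sums of the Fourier series of `1/2 - {t}`. -/
noncomputable def sawSum (N : ℕ) (t : ℝ) : ℝ :=
  ∑ n ∈ Finset.Icc 1 N, 1 / (Real.pi * n) * Real.sin (2 * Real.pi * n * t)

/-- The remainder of the sawtooth after its `N`-th Fourier partial sum. -/
noncomputable def sawRem (N : ℕ) (t : ℝ) : ℝ := Int.fract t - 1 / 2 + sawSum N t

theorem continuous_sawSum (N : ℕ) : Continuous (sawSum N) := by
  unfold sawSum; fun_prop

theorem sawRem_periodic (N : ℕ) : Function.Periodic (sawRem N) 1 := by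
  intro t
  unfold sawRem sawSum
  rw [Int.fract_add_one]
  congr 1
  refine Finset.sum_congr rfl fun n _ => ?_
  have : 2 * Real.pi * n * (t + 1) = 2 * Real.pi * n * t + n * (2 * Real.pi) := by ring
  rw [this, Real.sin_add_nat_mul_two_pi]

theorem measurable_sawRem (N : ℕ) : Measurable (sawRem N) := by
  unfold sawRem
  exact (measurable_fract.sub_const _).add (continuous_sawSum N).measurable

theorem abs_sawRem_le (N : ℕ) (t : ℝ) : |sawRem N t| ≤ 1 + N := by
  have h1 : |sawSum N t| ≤ N := by
    unfold sawSum
    refine (Finset.abs_sum_le_sum_abs _ _).trans ?_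
    calc _ ≤ ∑ n ∈ Finset.Icc 1 N, (1 : ℝ) := by
          apply Finset.sum_le_sum
          intro n hn
          have hn1 : (1 : ℝ) ≤ n := by exact_mod_cast (Finset.mem_Icc.mp hn).1
          have hp : 1 ≤ Real.pi * n := by nlinarith [Real.pi_gt_three]
          rw [abs_mul, abs_of_pos (by positivity)]
          exact mul_le_one₀ ((div_le_one (by positivity)).mpr hp) (abs_nonneg _)
            (Real.abs_sin_le_one _)
      _ = N := by simp
  have h2 : |Int.fract t - 1 / 2| ≤ 1 := by
    rw [abs_le]; constructor <;> linarith [Int.fract_nonneg t, Int.fract_lt_one t]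
  exact (abs_add_le _ _).trans (add_le_add h2 h1)

theorem intervalIntegrable_of_abs_le {f : ℝ → ℝ} (hf : Measurable f) {C : ℝ} (hC : ∀ x, |f x| ≤ C)
    (a b : ℝ) : IntervalIntegrable f volume a b := by
  rw [intervalIntegrable_iff]
  exact IntegrableOn.of_bound (by simp) hf.aestronglyMeasurable C
    (Filter.Eventually.of_forall hC)

theorem integral_cos_two_pi_int (k : ℤ) :
    ∫ t in (0 : ℝ)..1, Real.cos (2 * Real.pi * k * t) = if k = 0 then 1 else 0 := by
  split_ifs with hk
  · simp [hk]
  · have hne : 2 * Real.pi * (k : ℝ) ≠ 0 := by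
      have := Real.pi_pos; have : (k : ℝ) ≠ 0 := by exact_mod_cast hk
      positivity
    rw [intervalIntegral.integral_comp_mul_left (fun x => Real.cos x) hne, integral_cos]
    have : 2 * Real.pi * (k : ℝ) * 1 = k * (2 * Real.pi) := by ring
    rw [this, ← zero_add ((k : ℝ) * (2 * Real.pi)), Real.sin_add_int_mul_two_pi]
    simp

theorem integral_sin_mul_sin_two_pi {n m : ℕ} (hn : 1 ≤ n) :
    ∫ t in (0 : ℝ)..1, Real.sin (2 * Real.pi * n * t) * Real.sin (2 * Real.pi * m * t) =
      if n = m then 1 / 2 else 0 := by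
  have e : ∀ t : ℝ, Real.sin (2 * Real.pi * n * t) * Real.sin (2 * Real.pi * m * t) =
      1 / 2 * (Real.cos (2 * Real.pi * ((n - m : ℤ) : ℝ) * t) -
        Real.cos (2 * Real.pi * ((n + m : ℤ) : ℝ) * t)) := by
    intro t
    have e1 : 2 * Real.pi * ((n - m : ℤ) : ℝ) * t
      = 2 * Real.pi * n * t - 2 * Real.pi * m * t := by push_cast; ring
    have e2 : 2 * Real.pi * ((n + m : ℤ) : ℝ) * t
      = 2 * Real.pi * n * t + 2 * Real.pi * m * t := by push_cast; ring
    rw [e1, e2, Real.cos_sub, Real.cos_add]; ring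
  simp only [e]
  rw [intervalIntegral.integral_const_mul, intervalIntegral.integral_sub
    (Continuous.intervalIntegrable (by fun_prop) _ _)
    (Continuous.intervalIntegrable (by fun_prop) _ _),
    integral_cos_two_pi_int, integral_cos_two_pi_int]
  have h2 : ¬ ((n : ℤ) + m = 0) := by omega
  by_cases h : n = m
  · simp [h]; omega
  · have : ¬ ((n : ℤ) - m = 0) := by omega
    simp [h, h2, this]

theorem integral_sub_half_mul_sin {n : ℕ} (hn : 1 ≤ n) :
    ∫ t in (0 : ℝ)..1, (t - 1 / 2) * Real.sin (2 * Real.pi * n * t) =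
      -(1 / (2 * Real.pi * n)) := by
  have pn : (0 : ℝ) < n := by exact_mod_cast hn
  have hw : 2 * Real.pi * (n : ℝ) ≠ 0 := by have := Real.pi_pos; positivity
  set w := 2 * Real.pi * (n : ℝ) with hwdef
  have hd : ∀ t : ℝ, HasDerivAt
      (fun t => -((t - 1 / 2) * Real.cos (w * t) / w) + Real.sin (w * t) / w ^ 2)
      ((t - 1 / 2) * Real.sin (w * t)) t := by
    intro t
    have hl : HasDerivAt (fun t => w * t) w t := by
      simpa using (hasDerivAt_id t).const_mul w
    have h1 := (((hasDerivAt_id t).sub_const (1 / 2)).mul hl.cos).div_const w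
    have h2 := hl.sin.div_const (w ^ 2)
    refine (h1.neg.add h2).congr_deriv ?_
    simp only [id]
    field_simp
    ring
  rw [intervalIntegral.integral_eq_sub_of_hasDerivAt (fun t _ => hd t)
    (Continuous.intervalIntegrable (by fun_prop) _ _)]
  have hc : Real.cos (w * 1) = 1 := by
    rw [mul_one, hwdef]
    have : 2 * Real.pi * (n : ℝ) = n * (2 * Real.pi) := by ring
    rw [this, Real.cos_nat_mul_two_pi]
  have hs : Real.sin (w * 1) = 0 := by
    rw [mul_one, hwdef]
    have : 2 * Real.pi * (n : ℝ) = 0 + n * (2 * Real.pi) := by ring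
    rw [this, Real.sin_add_nat_mul_two_pi, Real.sin_zero]
  rw [hc, hs]
  simp
  field_simp
  norm_num

theorem zeta_two_tail_le {N : ℕ} (hN : 1 ≤ N) :
    Real.pi ^ 2 / 6 ≤ ∑ n ∈ Finset.Icc 1 N, 1 / (n : ℝ) ^ 2 + 1 / N := by
  have ht := hasSum_zeta_two.tendsto_sum_nat
  refine le_of_tendsto ht (Filter.eventually_atTop.mpr ⟨N + 1, fun M hM => ?_⟩)
  obtain ⟨M, rfl⟩ : ∃ k, M = k + 1 := ⟨M - 1, by omega⟩
  rw [Finset.sum_range_succ']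
  have e : ∑ k ∈ Finset.range M, 1 / ((k + 1 : ℕ) : ℝ) ^ 2 = ∑ n ∈ Finset.Icc 1 M, 1 / (n : ℝ) ^ 2 := by
    rw [Finset.range_eq_Ico, Finset.sum_Ico_add' (fun k : ℕ => 1 / (k : ℝ) ^ 2) 0 M 1]
    apply Finset.sum_congr _ fun _ _ => rfl
    ext; simp [Finset.mem_Ico, Finset.mem_Icc]
  rw [e]
  have hs : Finset.Icc 1 M = Finset.Icc 1 N ∪ Finset.Ioc N M := by
    ext k; simp only [Finset.mem_Icc, Finset.mem_union, Finset.mem_Ioc]; omega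
  have hdis : Disjoint (Finset.Icc 1 N) (Finset.Ioc N M) := by
    rw [Finset.disjoint_left]; intro k; simp only [Finset.mem_Icc, Finset.mem_Ioc]; omega
  rw [hs, Finset.sum_union hdis]
  have h := sum_Ioc_inv_sq_le_sub (α := ℝ) (k := N) (n := M) (by omega) (by omega)
  have hMn : (0 : ℝ) ≤ (M : ℝ)⁻¹ := by positivity
  simp only [one_div]
  simp
  linarith

theorem integral_sawRem_sq_le {N : ℕ} (hN : 1 ≤ N) :
    ∫ t in (0 : ℝ)..1, sawRem N t ^ 2 ≤ 1 / N := by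
  have hπ := Real.pi_pos
  have hcongr : ∫ t in (0 : ℝ)..1, sawRem N t ^ 2 =
      ∫ t in (0 : ℝ)..1, ((t - 1 / 2) ^ 2 + 2 * ((t - 1 / 2) * sawSum N t)
        + sawSum N t * sawSum N t) := by
    apply intervalIntegral.integral_congr_Ioo_of_le zero_le_one
    intro t ht
    have : Int.fract t = t := Int.fract_eq_self.mpr ⟨ht.1.le, ht.2⟩
    simp only [sawRem, this]; ring
  have hcs := continuous_sawSum N
  have hint : ∀ f : ℝ → ℝ, Continuous f → IntervalIntegrable f volume 0 1 :=
    fun f hf => hf.intervalIntegrable _ _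
  have h1 : ∫ t in (0 : ℝ)..1, (t - 1 / 2) ^ 2 = 1 / 12 := by
    rw [intervalIntegral.integral_comp_sub_right (fun t => t ^ 2), integral_pow]; norm_num
  have h2 : ∫ t in (0 : ℝ)..1, (t - 1 / 2) * sawSum N t =
      ∑ n ∈ Finset.Icc 1 N, -(1 / (2 * Real.pi ^ 2) * (1 / (n : ℝ) ^ 2)) := by
    have : ∀ t : ℝ, (t - 1 / 2) * sawSum N t = ∑ n ∈ Finset.Icc 1 N,
        1 / (Real.pi * n) * ((t - 1 / 2) * Real.sin (2 * Real.pi * n * t)) := by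
      intro t; rw [sawSum, Finset.mul_sum]
      exact Finset.sum_congr rfl fun n _ => by ring
    simp only [this]
    rw [intervalIntegral.integral_finsetSum fun i _ => hint _ (by fun_prop)]
    refine Finset.sum_congr rfl fun n hn => ?_
    have hn1 := (Finset.mem_Icc.mp hn).1
    have pn : (0 : ℝ) < n := by exact_mod_cast hn1
    rw [intervalIntegral.integral_const_mul, integral_sub_half_mul_sin hn1]
    field_simp
  have h3 : ∫ t in (0 : ℝ)..1, sawSum N t * sawSum N t =
      ∑ n ∈ Finset.Icc 1 N, 1 / (2 * Real.pi ^ 2) * (1 / (n : ℝ) ^ 2) := by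
    have : ∀ t : ℝ, sawSum N t * sawSum N t = ∑ n ∈ Finset.Icc 1 N, ∑ m ∈ Finset.Icc 1 N,
        1 / (Real.pi * n) * (1 / (Real.pi * m)) *
          (Real.sin (2 * Real.pi * n * t) * Real.sin (2 * Real.pi * m * t)) := by
      intro t; rw [sawSum, Finset.sum_mul_sum]
      exact Finset.sum_congr rfl fun n _ => Finset.sum_congr rfl fun m _ => by ring
    simp only [this]
    rw [intervalIntegral.integral_finsetSum fun i _ => hint _ (by fun_prop)]
    refine Finset.sum_congr rfl fun n hn => ?_
    have hn1 := (Finset.mem_Icc.mp hn).1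
    have pn : (0 : ℝ) < n := by exact_mod_cast hn1
    rw [intervalIntegral.integral_finsetSum fun i _ => hint _ (by fun_prop)]
    simp only [intervalIntegral.integral_const_mul, integral_sin_mul_sin_two_pi hn1, mul_ite,
      mul_zero]
    rw [Finset.sum_ite_eq, if_pos hn]
    field_simp
  rw [hcongr, intervalIntegral.integral_add (hint _ (by fun_prop)) (hint _ (by fun_prop)),
    intervalIntegral.integral_add (hint _ (by fun_prop)) (hint _ (by fun_prop)),
    intervalIntegral.integral_const_mul, h1, h2, h3, Finset.sum_neg_distrib, ← Finset.mul_sum]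
  have hz := zeta_two_tail_le hN
  set S := ∑ n ∈ Finset.Icc 1 N, 1 / (n : ℝ) ^ 2 with hS
  have pN : (0 : ℝ) < 1 / N := by
    have : (0 : ℝ) < N := by exact_mod_cast hN
    positivity
  have hk : 1 / (2 * Real.pi ^ 2) * (Real.pi ^ 2 / 6) = 1 / 12 := by field_simp; norm_num
  have hk0 : 0 < 1 / (2 * Real.pi ^ 2) := by positivity
  have hk1 : 1 / (2 * Real.pi ^ 2) ≤ 1 := by
    rw [div_le_one (by positivity)]; nlinarith [Real.pi_gt_three]
  have := mul_le_mul_of_nonneg_left hz hk0.le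
  rw [hk, mul_add] at this
  nlinarith [mul_le_mul_of_nonneg_right hk1 pN.le]

theorem integral_le_of_periodic {f : ℝ → ℝ} (hf : Function.Periodic f 1) (h0 : ∀ x, 0 ≤ f x)
    (hint : ∀ a b, IntervalIntegrable f volume a b) {a b : ℝ} (hab : a ≤ b) :
    ∫ x in a..b, f x ≤ (b - a + 1) * ∫ x in (0 : ℝ)..1, f x := by
  set k : ℤ := ⌈b - a⌉ with hk
  have hk1 : b ≤ a + k • (1 : ℝ) := by
    have := Int.le_ceil (b - a); rw [zsmul_one]; linarith
  have hk2 : (k : ℝ) ≤ b - a + 1 := (Int.ceil_lt_add_one (b - a)).le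
  have hI : 0 ≤ ∫ x in (0 : ℝ)..1, f x :=
    intervalIntegral.integral_nonneg zero_le_one fun x _ => h0 x
  calc ∫ x in a..b, f x ≤ ∫ x in a..(a + k • (1 : ℝ)), f x :=
        intervalIntegral.integral_mono_interval le_rfl hab hk1
          (Filter.Eventually.of_forall h0) (hint _ _)
    _ = k * ∫ x in (0 : ℝ)..1, f x := by
        rw [hf.intervalIntegral_add_zsmul_eq k a hint, zsmul_eq_mul,
          hf.intervalIntegral_add_eq a 0, zero_add]
    _ ≤ _ := mul_le_mul_of_nonneg_right hk2 hI

theorem measurable_sawRem_comp (N d : ℕ) (c : ℝ) :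
    Measurable fun x => sawRem N ((x + c) / (d : ℝ) ^ 2) :=
  (measurable_sawRem N).comp (by fun_prop)

theorem integral_sawRem_comp_sq_le {N d : ℕ} (hN : 1 ≤ N) (hd : 1 ≤ d) {X : ℝ} (hX : 0 ≤ X)
    (c : ℝ) :
    ∫ x in X..(2 * X), sawRem N ((x + c) / (d : ℝ) ^ 2) ^ 2 ≤ (X + (d : ℝ) ^ 2) / N := by
  have pd : (0 : ℝ) < (d : ℝ) ^ 2 := by
    have : (0 : ℝ) < d := by exact_mod_cast hd
    positivity
  simp only [add_div]
  rw [intervalIntegral.integral_comp_div_add (fun x => sawRem N x ^ 2) pd.ne', smul_eq_mul]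
  have hper : Function.Periodic (fun x => sawRem N x ^ 2) 1 := fun x => by
    simp only [sawRem_periodic N x]
  have hint : ∀ a b, IntervalIntegrable (fun x => sawRem N x ^ 2) volume a b :=
    intervalIntegrable_of_abs_le ((measurable_sawRem N).pow_const 2) (C := (1 + (N : ℝ)) ^ 2)
      fun x => by
        rw [abs_pow]; exact pow_le_pow_left₀ (abs_nonneg _) (abs_sawRem_le N x) 2
  have hle : X / (d : ℝ) ^ 2 + c / (d : ℝ) ^ 2 ≤ 2 * X / (d : ℝ) ^ 2 + c / (d : ℝ) ^ 2 := by
    gcongr; linarith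
  have h := integral_le_of_periodic hper (fun x => sq_nonneg _) hint hle
  calc _ ≤ (d : ℝ) ^ 2 * ((2 * X / (d : ℝ) ^ 2 + c / (d : ℝ) ^ 2 -
        (X / (d : ℝ) ^ 2 + c / (d : ℝ) ^ 2) + 1) * (1 / N)) := by
        apply mul_le_mul_of_nonneg_left _ pd.le
        refine h.trans (mul_le_mul_of_nonneg_left (integral_sawRem_sq_le hN) (by linarith))
    _ = _ := by field_simp; ring

theorem pairShortCount_sub_eq {x H : ℝ} (hx : 0 ≤ x) (hH : 0 ≤ H) (z : ℝ) :
    pairShortCount x H z - H * mertensTrunc z =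
      ∑ d ∈ Finset.Icc 1 ⌊Real.sqrt z⌋₊, (ArithmeticFunction.moebius d : ℝ) *
        (Int.fract (x / (d : ℝ) ^ 2) - Int.fract ((x + H) / (d : ℝ) ^ 2)) := by
  rw [pairShortCount, mertensTrunc, Finset.mul_sum, ← Finset.sum_sub_distrib]
  refine Finset.sum_congr rfl fun d _ => ?_
  have h1 : 0 ≤ x / (d : ℝ) ^ 2 := by positivity
  have h2 : 0 ≤ (x + H) / (d : ℝ) ^ 2 := by positivity
  have hle : x / (d : ℝ) ^ 2 ≤ (x + H) / (d : ℝ) ^ 2 := by gcongr; linarith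
  rw [Nat.card_Ioc, Nat.cast_sub (Nat.floor_mono hle), natCast_floor_eq_intCast_floor h1,
    natCast_floor_eq_intCast_floor h2, Int.fract, Int.fract]
  ring

/-- The truncated Fourier expansion of the centred count. -/
noncomputable def fourierTrunc (H : ℝ) (D N : ℕ) (x : ℝ) : ℝ :=
  ∑ p ∈ Finset.Icc 1 D ×ˢ Finset.Icc 1 N,
    2 * ((ArithmeticFunction.moebius p.1 : ℝ) * sawCoeff H p.1 p.2) *
      Real.cos (2 * Real.pi * freq p * (x + H / 2))

/-- The error of `fourierTrunc`. -/
noncomputable def fourierRem (H : ℝ) (D N : ℕ) (x : ℝ) : ℝ :=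
  ∑ d ∈ Finset.Icc 1 D, (ArithmeticFunction.moebius d : ℝ) *
    (sawRem N ((x + 0) / (d : ℝ) ^ 2) - sawRem N ((x + H) / (d : ℝ) ^ 2))

theorem sawSum_sub_sawSum (H x : ℝ) (d N : ℕ) :
    sawSum N ((x + H) / (d : ℝ) ^ 2) - sawSum N (x / (d : ℝ) ^ 2) =
      ∑ n ∈ Finset.Icc 1 N, 2 * sawCoeff H d n *
        Real.cos (2 * Real.pi * freq (d, n) * (x + H / 2)) := by
  rw [sawSum, sawSum, ← Finset.sum_sub_distrib]
  refine Finset.sum_congr rfl fun n _ => ?_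
  have e1 : 2 * Real.pi * n * ((x + H) / (d : ℝ) ^ 2) =
    2 * Real.pi * freq (d, n) * (x + H / 2) + Real.pi * n * H / (d : ℝ) ^ 2 := by
    simp only [freq]; ring
  have e2 : 2 * Real.pi * n * (x / (d : ℝ) ^ 2) =
    2 * Real.pi * freq (d, n) * (x + H / 2) - Real.pi * n * H / (d : ℝ) ^ 2 := by
    simp only [freq]; ring
  rw [e1, e2, Real.sin_add, Real.sin_sub, sawCoeff]
  ring

theorem sum_fract_eq_fourierTrunc_add (H x : ℝ) (D N : ℕ) :
    ∑ d ∈ Finset.Icc 1 D, (ArithmeticFunction.moebius d : ℝ) *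
        (Int.fract (x / (d : ℝ) ^ 2) - Int.fract ((x + H) / (d : ℝ) ^ 2)) =
      fourierTrunc H D N x + fourierRem H D N x := by
  rw [fourierTrunc, Finset.sum_product, fourierRem, ← Finset.sum_add_distrib]
  refine Finset.sum_congr rfl fun d _ => ?_
  have h := sawSum_sub_sawSum H x d N
  have e : ∑ n ∈ Finset.Icc 1 N, 2 * ((ArithmeticFunction.moebius (d, n).1 : ℝ) *
        sawCoeff H (d, n).1 (d, n).2) * Real.cos (2 * Real.pi * freq (d, n) * (x + H / 2))
      = (ArithmeticFunction.moebius d : ℝ) *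
        (sawSum N ((x + H) / (d : ℝ) ^ 2) - sawSum N (x / (d : ℝ) ^ 2)) := by
    rw [h, Finset.mul_sum]
    exact Finset.sum_congr rfl fun n _ => by ring
  rw [e, sawRem, sawRem, add_zero]
  ring

theorem abs_moebius_cast_le (d : ℕ) : |(ArithmeticFunction.moebius d : ℝ)| ≤ 1 := by
  exact_mod_cast ArithmeticFunction.abs_moebius_le_one

theorem fourierRem_sq_le (H : ℝ) (D N : ℕ) (x : ℝ) :
    fourierRem H D N x ^ 2 ≤ D * ∑ d ∈ Finset.Icc 1 D,
      (2 * sawRem N ((x + 0) / (d : ℝ) ^ 2) ^ 2 + 2 * sawRem N ((x + H) / (d : ℝ) ^ 2) ^ 2) := by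
  unfold fourierRem
  refine sq_sum_le_card_mul_sum_sq.trans ?_
  rw [Nat.card_Icc, Nat.add_sub_cancel]
  apply mul_le_mul_of_nonneg_left _ (Nat.cast_nonneg _)
  apply Finset.sum_le_sum
  intro d _
  set a := sawRem N ((x + 0) / (d : ℝ) ^ 2)
  set b := sawRem N ((x + H) / (d : ℝ) ^ 2)
  have hμ : (ArithmeticFunction.moebius d : ℝ) ^ 2 ≤ 1 := by
    rw [← sq_abs]; exact pow_le_one₀ (abs_nonneg _) (abs_moebius_cast_le d)
  rw [mul_pow]
  nlinarith [mul_le_mul_of_nonneg_right hμ (sq_nonneg (a - b)), sq_nonneg (a + b)]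

theorem integral_fourierRem_sq_le {H X : ℝ} {D N : ℕ} (hN : 1 ≤ N) (hX : 0 ≤ X) :
    ∫ x in X..(2 * X), fourierRem H D N x ^ 2 ≤ 4 * (D : ℝ) ^ 2 * (X + (D : ℝ) ^ 2) / N := by
  have hint : ∀ (d : ℕ) (c : ℝ), IntervalIntegrable
      (fun x => 2 * sawRem N ((x + c) / (d : ℝ) ^ 2) ^ 2) volume X (2 * X) := fun d c =>
    (intervalIntegrable_of_abs_le ((measurable_sawRem_comp N d c).pow_const 2)
      (C := (1 + (N : ℝ)) ^ 2) (fun x => by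
        rw [abs_pow]; exact pow_le_pow_left₀ (abs_nonneg _) (abs_sawRem_le N _) 2) _ _).const_mul 2
  have hint2 : IntervalIntegrable (fun x => (D : ℝ) * ∑ d ∈ Finset.Icc 1 D,
      (2 * sawRem N ((x + 0) / (d : ℝ) ^ 2) ^ 2 + 2 * sawRem N ((x + H) / (d : ℝ) ^ 2) ^ 2))
      volume X (2 * X) := by
    apply IntervalIntegrable.const_mul
    have := IntervalIntegrable.sum (μ := volume) (a := X) (b := 2 * X) (Finset.Icc 1 D)
      (f := fun d x => 2 * sawRem N ((x + 0) / (d : ℝ) ^ 2) ^ 2 +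
        2 * sawRem N ((x + H) / (d : ℝ) ^ 2) ^ 2) fun d _ => (hint d 0).add (hint d H)
    simpa only [Finset.sum_fn] using this
  have hmeas : Measurable (fourierRem H D N) := by
    unfold fourierRem
    exact Finset.measurable_fun_sum _ fun d _ =>
      ((measurable_sawRem_comp N d 0).sub (measurable_sawRem_comp N d H)).const_mul _
  have hint1 : IntervalIntegrable (fun x => fourierRem H D N x ^ 2) volume X (2 * X) :=
    hint2.mono_fun (hmeas.pow_const 2).aestronglyMeasurable
      (Filter.Eventually.of_forall fun x => by
        simp only [Real.norm_eq_abs]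
        rw [abs_of_nonneg (sq_nonneg _)]
        exact (fourierRem_sq_le H D N x).trans (le_abs_self _))
  calc _ ≤ ∫ x in X..(2 * X), (D : ℝ) * ∑ d ∈ Finset.Icc 1 D,
      (2 * sawRem N ((x + 0) / (d : ℝ) ^ 2) ^ 2 + 2 * sawRem N ((x + H) / (d : ℝ) ^ 2) ^ 2) :=
        intervalIntegral.integral_mono_on (by linarith) hint1 hint2
          fun x _ => fourierRem_sq_le H D N x
    _ = (D : ℝ) * ∑ d ∈ Finset.Icc 1 D, (2 * ∫ x in X..(2 * X), sawRem N ((x + 0) / (d : ℝ) ^ 2) ^ 2) +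
        (D : ℝ) * ∑ d ∈ Finset.Icc 1 D, (2 * ∫ x in X..(2 * X), sawRem N ((x + H) / (d : ℝ) ^ 2) ^ 2) := by
        rw [intervalIntegral.integral_const_mul, intervalIntegral.integral_finsetSum
          fun d _ => (hint d 0).add (hint d H), ← mul_add, ← Finset.sum_add_distrib]
        congr 1
        refine Finset.sum_congr rfl fun d _ => ?_
        rw [intervalIntegral.integral_add (hint d 0) (hint d H),
          intervalIntegral.integral_const_mul, intervalIntegral.integral_const_mul]
    _ ≤ (D : ℝ) * ∑ d ∈ Finset.Icc 1 D, (2 * ((X + (D : ℝ) ^ 2) / N)) +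
        (D : ℝ) * ∑ d ∈ Finset.Icc 1 D, (2 * ((X + (D : ℝ) ^ 2) / N)) := by
        have key : ∀ c : ℝ, ∀ d ∈ Finset.Icc 1 D,
            2 * ∫ x in X..(2 * X), sawRem N ((x + c) / (d : ℝ) ^ 2) ^ 2
              ≤ 2 * ((X + (D : ℝ) ^ 2) / N) := by
          intro c d hd
          rw [Finset.mem_Icc] at hd
          have : (d : ℝ) ≤ D := by exact_mod_cast hd.2
          apply mul_le_mul_of_nonneg_left _ zero_le_two
          refine (integral_sawRem_comp_sq_le hN hd.1 hX c).trans ?_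
          gcongr
        exact add_le_add
          (mul_le_mul_of_nonneg_left (Finset.sum_le_sum (key 0)) (Nat.cast_nonneg _))
          (mul_le_mul_of_nonneg_left (Finset.sum_le_sum (key H)) (Nat.cast_nonneg _))
    _ = _ := by
        simp only [Finset.sum_const, Nat.card_Icc, Nat.add_sub_cancel, nsmul_eq_mul]; ring

theorem abs_mean_sq_sub_fourierTrunc_le {X H z : ℝ} (hX : 1 ≤ X) (hH : 0 ≤ H) {N : ℕ}
    (hD : (⌊Real.sqrt z⌋₊ : ℝ) ^ 2 ≤ X) (hN : X ^ 2 ≤ N) :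
    |1 / X * (∫ x in X..(2 * X), |pairShortCount x H z - H * mertensTrunc z| ^ 2) -
      1 / X * (∫ x in X..(2 * X), fourierTrunc H ⌊Real.sqrt z⌋₊ N x ^ 2)| ≤ 17 := by
  have pX : 0 < X := by linarith
  have pN : (0 : ℝ) < N := by nlinarith
  have hN1 : 1 ≤ N := by exact_mod_cast (by exact_mod_cast pN : 0 < N)
  set D := ⌊Real.sqrt z⌋₊ with hDdef
  set F : ℝ → ℝ := fun x => ∑ d ∈ Finset.Icc 1 D, (ArithmeticFunction.moebius d : ℝ) *
        (Int.fract (x / (d : ℝ) ^ 2) - Int.fract ((x + H) / (d : ℝ) ^ 2)) with hF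
  have hFG : ∀ x, F x = fourierTrunc H D N x + fourierRem H D N x :=
    fun x => sum_fract_eq_fourierTrunc_add H x D N
  have hFle : ∀ x, |F x| ≤ D := by
    intro x
    refine (Finset.abs_sum_le_sum_abs _ _).trans ?_
    calc _ ≤ ∑ d ∈ Finset.Icc 1 D, (1 : ℝ) := by
          apply Finset.sum_le_sum
          intro d _
          rw [abs_mul]
          refine mul_le_one₀ (abs_moebius_cast_le d) (abs_nonneg _) ?_
          rw [abs_le]
          constructor <;> linarith [Int.fract_nonneg (x / (d : ℝ) ^ 2),
            Int.fract_lt_one (x / (d : ℝ) ^ 2), Int.fract_nonneg ((x + H) / (d : ℝ) ^ 2),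
            Int.fract_lt_one ((x + H) / (d : ℝ) ^ 2)]
      _ = D := by simp
  have hFmeas : Measurable F := by
    apply Finset.measurable_fun_sum
    intro d _
    apply Measurable.const_mul
    exact (Measurable.fract (by fun_prop)).sub (Measurable.fract (by fun_prop))
  have hGcont : Continuous (fourierTrunc H D N) := by unfold fourierTrunc; fun_prop
  have hF2 : ∀ x, |F x ^ 2| ≤ (D : ℝ) ^ 2 := fun x => by
    rw [abs_pow]; exact pow_le_pow_left₀ (abs_nonneg _) (hFle x) 2
  have hFint : IntervalIntegrable (fun x => F x ^ 2) volume X (2 * X) :=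
    intervalIntegrable_of_abs_le (hFmeas.pow_const 2) hF2 _ _
  have hGint : IntervalIntegrable (fun x => fourierTrunc H D N x ^ 2) volume X (2 * X) :=
    (hGcont.pow 2).intervalIntegrable _ _
  have hRint : IntervalIntegrable (fun x => fourierRem H D N x ^ 2) volume X (2 * X) := by
    have hR : ∀ x, fourierRem H D N x ^ 2 = F x ^ 2 - 2 * (F x * fourierTrunc H D N x) +
        fourierTrunc H D N x ^ 2 := fun x => by rw [hFG]; ring
    simp only [hR]
    have hFi : IntervalIntegrable F volume X (2 * X) :=
      intervalIntegrable_of_abs_le hFmeas hFle _ _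
    exact (hFint.sub ((hFi.mul_continuousOn hGcont.continuousOn).const_mul 2)).add hGint
  have hcongr : ∫ x in X..(2 * X), |pairShortCount x H z - H * mertensTrunc z| ^ 2 =
      ∫ x in X..(2 * X), F x ^ 2 := by
    apply intervalIntegral.integral_congr
    intro x hx
    rw [Set.uIcc_of_le (by linarith)] at hx
    simp only
    rw [sq_abs, pairShortCount_sub_eq (pX.le.trans hx.1) hH]
  rw [hcongr, ← mul_sub, ← intervalIntegral.integral_sub hFint hGint, abs_mul,
    abs_of_pos (one_div_pos.mpr pX), one_div, inv_mul_le_iff₀ pX]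
  have hpt : ∀ x, |F x ^ 2 - fourierTrunc H D N x ^ 2| ≤
      1 + ((D : ℝ) ^ 2 + 1) * fourierRem H D N x ^ 2 := by
    intro x
    have h1 := abs_le.mp (hFle x)
    have hG : fourierTrunc H D N x = F x - fourierRem H D N x := by rw [hFG]; ring
    rw [hG]
    set r := fourierRem H D N x
    have h2 : (F x) ^ 2 ≤ (D : ℝ) ^ 2 := (le_abs_self _).trans (hF2 x)
    have h3 := mul_le_mul_of_nonneg_right h2 (sq_nonneg r)
    rw [abs_le]
    constructor <;> nlinarith [sq_nonneg (F x * r - 1), sq_nonneg (F x * r + 1), sq_nonneg r]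
  have hmono := intervalIntegral.abs_integral_le_integral_abs (μ := volume)
    (a := X) (b := 2 * X) (f := fun x => F x ^ 2 - fourierTrunc H D N x ^ 2) (by linarith)
  refine hmono.trans ?_
  calc _ ≤ ∫ x in X..(2 * X), (1 + ((D : ℝ) ^ 2 + 1) * fourierRem H D N x ^ 2) :=
        intervalIntegral.integral_mono_on (by linarith) (hFint.sub hGint).abs
          (intervalIntegrable_const.add (hRint.const_mul _)) fun x _ => hpt x
    _ = X + ((D : ℝ) ^ 2 + 1) * ∫ x in X..(2 * X), fourierRem H D N x ^ 2 := by
        rw [intervalIntegral.integral_add intervalIntegrable_const (hRint.const_mul _),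
          intervalIntegral.integral_const_mul, intervalIntegral.integral_const]
        simp; ring
    _ ≤ X + (2 * X) * (4 * X * (2 * X) / N) := by
        have h1 := integral_fourierRem_sq_le (H := H) (D := D) hN1 pX.le
        have h2 : 4 * (D : ℝ) ^ 2 * (X + (D : ℝ) ^ 2) / N ≤ 4 * X * (2 * X) / N := by
          gcongr; linarith
        have h0 : 0 ≤ ∫ x in X..(2 * X), fourierRem H D N x ^ 2 :=
          intervalIntegral.integral_nonneg (by linarith) fun x _ => sq_nonneg _
        gcongr
        · linarith
        · exact h1.trans h2
    _ ≤ X * 17 := by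
        have : (2 * X) * (4 * X * (2 * X) / N) = 16 * X * (X ^ 2 / N) := by ring
        rw [this]
        have h3 : X ^ 2 / N ≤ 1 := (div_le_one pN).mpr hN
        nlinarith

theorem sum_ite_div_eq {d₁ d₂ : ℕ} (hd₁ : 1 ≤ d₁) (hd₂ : 1 ≤ d₂) (N : ℕ) (f : ℕ → ℕ → ℝ) :
    ∑ n₁ ∈ Finset.Icc 1 N, ∑ n₂ ∈ Finset.Icc 1 N,
        (if (n₁ : ℝ) / (d₁ : ℝ) ^ 2 = (n₂ : ℝ) / (d₂ : ℝ) ^ 2 then f n₁ n₂ else 0) =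
      ∑ l ∈ Finset.Icc 1 (N / max ((d₁ / d₁.gcd d₂) ^ 2) ((d₂ / d₁.gcd d₂) ^ 2)),
        f (l * (d₁ / d₁.gcd d₂) ^ 2) (l * (d₂ / d₁.gcd d₂) ^ 2) := by
  have hg : 0 < d₁.gcd d₂ := Nat.gcd_pos_of_pos_left _ hd₁
  have hcop : Nat.Coprime (d₁ / d₁.gcd d₂) (d₂ / d₁.gcd d₂) := Nat.coprime_div_gcd_div_gcd hg
  have e₁ : d₁ / d₁.gcd d₂ * d₁.gcd d₂ = d₁ := Nat.div_mul_cancel (Nat.gcd_dvd_left _ _)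
  have e₂ : d₂ / d₁.gcd d₂ * d₁.gcd d₂ = d₂ := Nat.div_mul_cancel (Nat.gcd_dvd_right _ _)
  have ha : 0 < d₁ / d₁.gcd d₂ := Nat.pos_of_mul_pos_right (e₁ ▸ hd₁)
  have hb : 0 < d₂ / d₁.gcd d₂ := Nat.pos_of_mul_pos_right (e₂ ▸ hd₂)
  generalize d₁.gcd d₂ = g at *
  generalize d₁ / g = a at *
  generalize d₂ / g = b at *
  subst e₁ e₂
  have heq : ∀ n₁ n₂ : ℕ, ((n₁ : ℝ) / ((a * g : ℕ) : ℝ) ^ 2 = (n₂ : ℝ) / ((b * g : ℕ) : ℝ) ^ 2) ↔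
      n₁ * b ^ 2 = n₂ * a ^ 2 := by
    intro n₁ n₂
    have pg : (0 : ℝ) < g := by exact_mod_cast hg
    have pa : (0 : ℝ) < a := by exact_mod_cast ha
    have pb : (0 : ℝ) < b := by exact_mod_cast hb
    rw [div_eq_div_iff (by positivity) (by positivity)]
    push_cast
    rw [mul_pow, mul_pow, ← mul_assoc, ← mul_assoc, mul_left_inj' (by positivity)]
    exact_mod_cast Iff.rfl
  simp only [heq]
  rw [← Finset.sum_product', ← Finset.sum_filter]
  symm
  refine Finset.sum_bij (fun l _ => (l * a ^ 2, l * b ^ 2)) ?_ ?_ ?_ ?_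
  · intro l hl
    rw [Finset.mem_Icc, Nat.le_div_iff_mul_le (by positivity)] at hl
    have h₁ : l * a ^ 2 ≤ l * max (a ^ 2) (b ^ 2) := Nat.mul_le_mul_left _ (le_max_left _ _)
    have h₂ : l * b ^ 2 ≤ l * max (a ^ 2) (b ^ 2) := Nat.mul_le_mul_left _ (le_max_right _ _)
    have h₃ : 0 < l * a ^ 2 := Nat.mul_pos hl.1 (by positivity)
    have h₄ : 0 < l * b ^ 2 := Nat.mul_pos hl.1 (by positivity)
    simp only [Finset.mem_filter, Finset.mem_product, Finset.mem_Icc]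
    exact ⟨⟨⟨h₃, h₁.trans hl.2⟩, h₄, h₂.trans hl.2⟩, by ring⟩
  · intro l _ l' _ h
    exact Nat.eq_of_mul_eq_mul_right (by positivity : 0 < a ^ 2) (Prod.mk.inj h).1
  · rintro ⟨n₁, n₂⟩ h
    simp only [Finset.mem_filter, Finset.mem_product, Finset.mem_Icc] at h
    obtain ⟨⟨⟨h₁, h₁'⟩, h₂, h₂'⟩, h₃⟩ := h
    obtain ⟨l, rfl⟩ : a ^ 2 ∣ n₁ :=
      (Nat.Coprime.pow 2 2 hcop).dvd_of_dvd_mul_right (h₃ ▸ Dvd.intro_left _ rfl)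
    have h₄ : n₂ = l * b ^ 2 :=
      Nat.eq_of_mul_eq_mul_right (by positivity : 0 < a ^ 2) (by rw [← h₃]; ring)
    subst h₄
    refine ⟨l, ?_, by rw [mul_comm]⟩
    rw [Finset.mem_Icc, Nat.le_div_iff_mul_le (by positivity)]
    refine ⟨Nat.pos_of_mul_pos_left h₁, ?_⟩
    rcases max_choice (a ^ 2) (b ^ 2) with h | h <;> rw [h]
    · rwa [mul_comm]
    · exact h₂'
  · intro l _; rfl

theorem sawCoeff_mul_sq {H : ℝ} (hH : 0 < H) {a g l : ℕ} (ha : 1 ≤ a) (hg : 1 ≤ g) (hl : 1 ≤ l) :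
    sawCoeff H (a * g) (l * a ^ 2) =
      H / ((a * g : ℕ) : ℝ) ^ 2 * sinc (H * (l : ℝ) / ((g ^ 2 : ℕ) : ℝ)) := by
  have pa : (0 : ℝ) < a := by exact_mod_cast ha
  have pg : (0 : ℝ) < g := by exact_mod_cast hg
  have pl : (0 : ℝ) < l := by exact_mod_cast hl
  have pp := Real.pi_pos
  have h1 : H * (l : ℝ) / ((g ^ 2 : ℕ) : ℝ) ≠ 0 := by push_cast; positivity
  rw [sawCoeff, sinc, if_neg h1]
  have h2 : Real.pi * ((l * a ^ 2 : ℕ) : ℝ) * H / ((a * g : ℕ) : ℝ) ^ 2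
      = Real.pi * (H * (l : ℝ) / ((g ^ 2 : ℕ) : ℝ)) := by
    push_cast; field_simp
  rw [h2]
  push_cast
  field_simp

theorem tsum_pnat_sub_sum_le {F : ℕ → ℝ} {C : ℝ}
    (hF0 : ∀ l, 0 ≤ F l) (hF : ∀ l, 1 ≤ l → F l ≤ C * ((l : ℝ) ^ 2)⁻¹) (hC : 0 ≤ C) (M : ℕ) :
    |∑ l ∈ Finset.Icc 1 M, F l - ∑' l : ℕ+, F l| ≤ C * (2 / (M + 1)) := by
  have htail : ∀ k m : ℕ, ∑ i ∈ Finset.range m, F (i + (k + 1)) ≤ C * (2 / (k + 1)) := by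
    intro k m
    calc _ ≤ ∑ i ∈ Finset.range m, C * (((i + (k + 1) : ℕ) : ℝ) ^ 2)⁻¹ :=
          Finset.sum_le_sum fun i _ => hF _ (by omega)
      _ = C * ∑ i ∈ Finset.Ioo k (m + (k + 1)), ((i : ℝ) ^ 2)⁻¹ := by
          rw [Finset.mul_sum]
          refine Finset.sum_bij (fun i _ => i + (k + 1)) ?_ ?_ ?_ ?_
          · intro i hi; rw [Finset.mem_range] at hi; rw [Finset.mem_Ioo]; omega
          · intro i _ j _ h; omega
          · intro j hj; rw [Finset.mem_Ioo] at hj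
            exact ⟨j - (k + 1), by rw [Finset.mem_range]; omega, by omega⟩
          · intro i _; rfl
      _ ≤ _ := mul_le_mul_of_nonneg_left (sum_Ioo_inv_sq_le k _) hC
  have hsum : Summable fun i : ℕ => F (i + 1) :=
    summable_of_sum_range_le (fun i => hF0 _) fun m => htail 0 m
  have e : ∑ l ∈ Finset.Icc 1 M, F l = ∑ i ∈ Finset.range M, F (i + 1) := by
    rw [Finset.range_eq_Ico, Finset.sum_Ico_add' F 0 M 1]
    rfl
  have h1 := hsum.sum_add_tsum_nat_add M
  rw [tsum_pnat_eq_tsum_succ (f := F), e, ← h1, sub_add_cancel_left, abs_neg,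
    abs_of_nonneg (tsum_nonneg fun i => hF0 _)]
  exact Real.tsum_le_of_sum_range_le (fun i => hF0 _) fun m => htail M m

theorem abs_diag_pair_sub_le {H : ℝ} (hH : 0 < H) {d₁ d₂ N : ℕ} (hd₁ : 1 ≤ d₁) (hd₂ : 1 ≤ d₂)
    (hN : 1 ≤ N) :
    |∑ n₁ ∈ Finset.Icc 1 N, ∑ n₂ ∈ Finset.Icc 1 N,
        (if (n₁ : ℝ) / (d₁ : ℝ) ^ 2 = (n₂ : ℝ) / (d₂ : ℝ) ^ 2 then
          sawCoeff H d₁ n₁ * sawCoeff H d₂ n₂ else 0) -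
      H ^ 2 / ((d₁ : ℝ) ^ 2 * (d₂ : ℝ) ^ 2) *
        ∑' l : ℕ+, sinc (H * ((l : ℕ) : ℝ) / (Nat.gcd (d₁ ^ 2) (d₂ ^ 2) : ℝ)) ^ 2| ≤ 2 / N := by
  rw [sum_ite_div_eq hd₁ hd₂ N fun n₁ n₂ => sawCoeff H d₁ n₁ * sawCoeff H d₂ n₂]
  have hgg : Nat.gcd (d₁ ^ 2) (d₂ ^ 2) = d₁.gcd d₂ ^ 2 := Nat.pow_gcd_pow
  rw [hgg]
  have hg : 0 < d₁.gcd d₂ := Nat.gcd_pos_of_pos_left _ hd₁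
  have e₁ : d₁ / d₁.gcd d₂ * d₁.gcd d₂ = d₁ := Nat.div_mul_cancel (Nat.gcd_dvd_left _ _)
  have e₂ : d₂ / d₁.gcd d₂ * d₁.gcd d₂ = d₂ := Nat.div_mul_cancel (Nat.gcd_dvd_right _ _)
  have ha : 0 < d₁ / d₁.gcd d₂ := Nat.pos_of_mul_pos_right (e₁ ▸ hd₁)
  have hb : 0 < d₂ / d₁.gcd d₂ := Nat.pos_of_mul_pos_right (e₂ ▸ hd₂)
  clear hgg
  generalize d₁.gcd d₂ = g at *
  generalize d₁ / g = a at *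
  generalize d₂ / g = b at *
  subst e₁ e₂
  have pg : (0 : ℝ) < g := by exact_mod_cast hg
  have pa : (0 : ℝ) < a := by exact_mod_cast ha
  have pb : (0 : ℝ) < b := by exact_mod_cast hb
  have pN : (0 : ℝ) < N := by exact_mod_cast hN
  set F : ℕ → ℝ := fun l => H ^ 2 / (((a * g : ℕ) : ℝ) ^ 2 * ((b * g : ℕ) : ℝ) ^ 2) *
    sinc (H * (l : ℝ) / ((g ^ 2 : ℕ) : ℝ)) ^ 2 with hFdef
  have hFeq : ∀ l, 1 ≤ l →
      sawCoeff H (a * g) (l * a ^ 2) * sawCoeff H (b * g) (l * b ^ 2) = F l := by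
    intro l hl
    rw [sawCoeff_mul_sq hH ha hg hl, sawCoeff_mul_sq hH hb hg hl, hFdef]
    ring
  have hF0 : ∀ l, 0 ≤ F l := fun l => by rw [hFdef]; positivity
  have hF : ∀ l, 1 ≤ l → F l ≤ 1 / ((a : ℝ) ^ 2 * (b : ℝ) ^ 2) * ((l : ℝ) ^ 2)⁻¹ := by
    intro l hl
    have pl : (0 : ℝ) < l := by exact_mod_cast hl
    rw [← hFeq l hl]
    refine (le_abs_self _).trans ?_
    rw [abs_mul]
    have h₁ := abs_sawCoeff_le_inv H (a * g) (n := l * a ^ 2) (Nat.mul_pos hl (by positivity))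
    have h₂ := abs_sawCoeff_le_inv H (b * g) (n := l * b ^ 2) (Nat.mul_pos hl (by positivity))
    refine (mul_le_mul h₁ h₂ (abs_nonneg _) (by positivity)).trans (le_of_eq ?_)
    push_cast
    field_simp
  have hmain := tsum_pnat_sub_sum_le hF0 hF (by positivity) (N / max (a ^ 2) (b ^ 2))
  rw [Finset.sum_congr rfl fun l hl => hFeq l (Finset.mem_Icc.mp hl).1, ← tsum_mul_left]
  refine hmain.trans ?_
  have hM : N < max (a ^ 2) (b ^ 2) * (N / max (a ^ 2) (b ^ 2) + 1) :=
    Nat.lt_mul_div_succ N (by positivity)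
  have hmax : max (a ^ 2) (b ^ 2) ≤ a ^ 2 * b ^ 2 :=
    max_le (Nat.le_mul_of_pos_right _ (by positivity)) (Nat.le_mul_of_pos_left _ (by positivity))
  have hle : (N : ℝ) ≤ (a : ℝ) ^ 2 * (b : ℝ) ^ 2 * (((N / max (a ^ 2) (b ^ 2) : ℕ) : ℝ) + 1) := by
    exact_mod_cast hM.le.trans (Nat.mul_le_mul_right _ hmax)
  rw [div_mul_div_comm, one_mul]
  gcongr

/-- The diagonal of the mean square of `fourierTrunc`. -/
noncomputable def fourierDiag (H : ℝ) (D N : ℕ) : ℝ :=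
  1 / 2 * ∑ p ∈ Finset.Icc 1 D ×ˢ Finset.Icc 1 N, ∑ q ∈ Finset.Icc 1 D ×ˢ Finset.Icc 1 N,
    if freq p = freq q then
      (2 * ((ArithmeticFunction.moebius p.1 : ℝ) * sawCoeff H p.1 p.2)) *
        (2 * ((ArithmeticFunction.moebius q.1 : ℝ) * sawCoeff H q.1 q.2)) else 0

theorem sum_ite_eq_mul_nonneg {ι κ : Type*} [DecidableEq κ] (P : Finset ι) (v : ι → κ)
    (a : ι → ℝ) : 0 ≤ ∑ p ∈ P, ∑ q ∈ P, if v p = v q then a p * a q else 0 := by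
  have : ∑ p ∈ P, ∑ q ∈ P, (if v p = v q then a p * a q else 0)
      = ∑ k ∈ P.image v, (∑ p ∈ P, if v p = k then a p else 0) ^ 2 := by
    simp only [sq, Finset.sum_mul_sum]
    symm
    rw [Finset.sum_comm]
    refine Finset.sum_congr rfl fun p hp => ?_
    rw [Finset.sum_comm]
    refine Finset.sum_congr rfl fun q _ => ?_
    rw [Finset.sum_eq_single (v p)]
    · simp [eq_comm]
    · intro k _ hk; simp [hk.symm]
    · intro h; exact absurd (Finset.mem_image_of_mem v hp) h
  rw [this]
  exact Finset.sum_nonneg fun _ _ => sq_nonneg _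

theorem fourierDiag_nonneg (H : ℝ) (D N : ℕ) : 0 ≤ fourierDiag H D N :=
  mul_nonneg (by norm_num) (sum_ite_eq_mul_nonneg _ _ _)

theorem abs_fourierDiag_sub_diagMain_le {H : ℝ} (hH : 0 < H) (z : ℝ) {N : ℕ} (hN : 1 ≤ N) :
    |fourierDiag H ⌊Real.sqrt z⌋₊ N - diagMain H z| ≤ 4 * (⌊Real.sqrt z⌋₊ : ℝ) ^ 2 / N := by
  have e₁ : fourierDiag H ⌊Real.sqrt z⌋₊ N = 2 *
      ∑ d₁ ∈ Finset.Icc 1 ⌊Real.sqrt z⌋₊, ∑ d₂ ∈ Finset.Icc 1 ⌊Real.sqrt z⌋₊,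
        (ArithmeticFunction.moebius d₁ : ℝ) * (ArithmeticFunction.moebius d₂ : ℝ) *
        ∑ n₁ ∈ Finset.Icc 1 N, ∑ n₂ ∈ Finset.Icc 1 N,
        (if (n₁ : ℝ) / (d₁ : ℝ) ^ 2 = (n₂ : ℝ) / (d₂ : ℝ) ^ 2 then
          sawCoeff H d₁ n₁ * sawCoeff H d₂ n₂ else 0) := by
    rw [fourierDiag]
    simp only [Finset.sum_product, Finset.mul_sum]
    refine Finset.sum_congr rfl fun d₁ _ => ?_
    rw [Finset.sum_comm]
    refine Finset.sum_congr rfl fun d₂ _ => ?_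
    refine Finset.sum_congr rfl fun n₁ _ => Finset.sum_congr rfl fun n₂ _ => ?_
    by_cases h : freq (d₁, n₁) = freq (d₂, n₂)
    · rw [if_pos h, if_pos (by exact h)]; ring
    · rw [if_neg h, if_neg (by exact h)]; ring
  have e₂ : diagMain H z = 2 *
      ∑ d₁ ∈ Finset.Icc 1 ⌊Real.sqrt z⌋₊, ∑ d₂ ∈ Finset.Icc 1 ⌊Real.sqrt z⌋₊,
        (ArithmeticFunction.moebius d₁ : ℝ) * (ArithmeticFunction.moebius d₂ : ℝ) *
        (H ^ 2 / ((d₁ : ℝ) ^ 2 * (d₂ : ℝ) ^ 2) *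
        ∑' l : ℕ+, sinc (H * ((l : ℕ) : ℝ) / (Nat.gcd (d₁ ^ 2) (d₂ ^ 2) : ℝ)) ^ 2) := by
    rw [diagMain]
    simp only [Finset.mul_sum]
    refine Finset.sum_congr rfl fun d₁ _ => Finset.sum_congr rfl fun d₂ _ => ?_
    ring
  rw [e₁, e₂, ← mul_sub, abs_mul, abs_two, ← Finset.sum_sub_distrib]
  simp only [← Finset.sum_sub_distrib, ← mul_sub]
  calc _ ≤ 2 * ∑ d₁ ∈ Finset.Icc 1 ⌊Real.sqrt z⌋₊, ∑ d₂ ∈ Finset.Icc 1 ⌊Real.sqrt z⌋₊,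
        (2 / (N : ℝ)) := by
        refine mul_le_mul_of_nonneg_left ?_ zero_le_two
        refine (Finset.abs_sum_le_sum_abs _ _).trans (Finset.sum_le_sum fun d₁ h₁ => ?_)
        refine (Finset.abs_sum_le_sum_abs _ _).trans (Finset.sum_le_sum fun d₂ h₂ => ?_)
        rw [Finset.mem_Icc] at h₁ h₂
        rw [abs_mul, abs_mul]
        refine (mul_le_of_le_one_left (abs_nonneg _) ?_).trans (abs_diag_pair_sub_le hH h₁.1 h₂.1 hN)
        exact mul_le_one₀ (abs_moebius_cast_le _) (abs_nonneg _) (abs_moebius_cast_le _)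
    _ = _ := by
        simp only [Finset.sum_const, Nat.card_Icc, Nat.add_sub_cancel, nsmul_eq_mul]; ring

theorem diagMain_nonneg {H : ℝ} (hH : 0 < H) (z : ℝ) : 0 ≤ diagMain H z := by
  have hlim : Filter.Tendsto (fun N : ℕ => 4 * (⌊Real.sqrt z⌋₊ : ℝ) ^ 2 / N) Filter.atTop
      (nhds 0) := tendsto_const_div_atTop_nhds_zero_nat _
  have : -diagMain H z ≤ 0 := by
    refine ge_of_tendsto hlim ?_
    filter_upwards [Filter.eventually_ge_atTop 1] with N hN
    have h := (le_abs_self _).trans (abs_fourierDiag_sub_diagMain_le hH z hN)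
    linarith [fourierDiag_nonneg H ⌊Real.sqrt z⌋₊ N]
  linarith

theorem abs_mean_fourierTrunc_sq_sub_diag_le {X : ℝ} (hX : 0 < X) (H : ℝ) (D N : ℕ) :
    |1 / X * (∫ x in X..(2 * X), fourierTrunc H D N x ^ 2) - fourierDiag H D N| ≤
      2 * (∑ p ∈ Finset.Icc 1 D ×ˢ Finset.Icc 1 N, ∑ q ∈ Finset.Icc 1 D ×ˢ Finset.Icc 1 N,
        |sawCoeff H p.1 p.2| * |sawCoeff H q.1 q.2| * oscBound X (freq p - freq q) +
      ∑ p ∈ Finset.Icc 1 D ×ˢ Finset.Icc 1 N, ∑ q ∈ Finset.Icc 1 D ×ˢ Finset.Icc 1 N,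
        |sawCoeff H p.1 p.2| * |sawCoeff H q.1 q.2| * (1 / (X * (freq p + freq q)))) := by
  have hpos : ∀ p ∈ Finset.Icc 1 D ×ˢ Finset.Icc 1 N, 0 < freq p := by
    intro p hp
    simp only [Finset.mem_product, Finset.mem_Icc] at hp
    have h₁ : (0 : ℝ) < p.1 := by exact_mod_cast hp.1.1
    have h₂ : (0 : ℝ) < p.2 := by exact_mod_cast hp.2.1
    unfold freq
    positivity
  have ha : ∀ p : ℕ × ℕ, |2 * ((ArithmeticFunction.moebius p.1 : ℝ) * sawCoeff H p.1 p.2)| ≤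
      2 * |sawCoeff H p.1 p.2| := by
    intro p
    rw [abs_mul, abs_mul, abs_two]
    exact mul_le_mul_of_nonneg_left
      (mul_le_of_le_one_left (abs_nonneg _) (abs_moebius_cast_le _)) zero_le_two
  have key : ∀ w : ℕ × ℕ → ℕ × ℕ → ℝ,
      (∀ p ∈ Finset.Icc 1 D ×ˢ Finset.Icc 1 N, ∀ q ∈ Finset.Icc 1 D ×ˢ Finset.Icc 1 N,
        0 ≤ w p q) →
      ∑ p ∈ Finset.Icc 1 D ×ˢ Finset.Icc 1 N, ∑ q ∈ Finset.Icc 1 D ×ˢ Finset.Icc 1 N,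
        |2 * ((ArithmeticFunction.moebius p.1 : ℝ) * sawCoeff H p.1 p.2)| *
          |2 * ((ArithmeticFunction.moebius q.1 : ℝ) * sawCoeff H q.1 q.2)| * w p q ≤
      4 * ∑ p ∈ Finset.Icc 1 D ×ˢ Finset.Icc 1 N, ∑ q ∈ Finset.Icc 1 D ×ˢ Finset.Icc 1 N,
        |sawCoeff H p.1 p.2| * |sawCoeff H q.1 q.2| * w p q := by
    intro w hw
    simp only [Finset.mul_sum]
    refine Finset.sum_le_sum fun p hp => Finset.sum_le_sum fun q hq => ?_
    rw [← mul_assoc (4 : ℝ)]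
    refine mul_le_mul_of_nonneg_right ?_ (hw p hp q hq)
    refine (mul_le_mul (ha p) (ha q) (abs_nonneg _) (by positivity)).trans (le_of_eq (by ring))
  refine (abs_mean_sq_sub_diag_le (Finset.Icc 1 D ×ˢ Finset.Icc 1 N)
    (fun p => 2 * ((ArithmeticFunction.moebius p.1 : ℝ) * sawCoeff H p.1 p.2)) freq hX hpos
    (H / 2)).trans ?_
  have k₁ := key (fun p q => oscBound X (freq p - freq q)) fun _ _ _ _ => oscBound_nonneg hX.le _
  have k₂ := key (fun p q => 1 / (X * (freq p + freq q))) fun p hp q hq => by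
    have := hpos p hp
    have := hpos q hq
    positivity
  linarith

theorem abs_mean_sub_diagMain_le {X H z : ℝ} (hX : 1 ≤ X) (hH : 0 < H) (hz : 0 ≤ z)
    (hzX : z ≤ X) :
    |1 / X * (∫ x in X..(2 * X), |pairShortCount x H z - H * mertensTrunc z| ^ 2) -
        diagMain H z| ≤
      21 + 200 * (1 + Real.log X) ^ 4 * (z / Real.sqrt X + H * z / X) := by
  have pX : 0 < X := by linarith
  have hD : (⌊Real.sqrt z⌋₊ : ℝ) ^ 2 ≤ z := by
    calc _ ≤ Real.sqrt z ^ 2 :=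
          pow_le_pow_left₀ (Nat.cast_nonneg _) (Nat.floor_le (Real.sqrt_nonneg _)) 2
      _ = z := Real.sq_sqrt hz
  set N := ⌈X ^ 2⌉₊ with hNdef
  have hN : X ^ 2 ≤ N := Nat.le_ceil _
  have hX2 : 1 ≤ X ^ 2 := one_le_pow₀ hX
  have hN2 : (N : ℝ) ≤ 2 * X ^ 2 := by
    have := Nat.ceil_lt_add_one (sq_nonneg X)
    linarith
  have pN : (0 : ℝ) < N := by linarith
  have hN1 : 1 ≤ N := by exact_mod_cast (by exact_mod_cast pN : 0 < N)
  have hDN : ⌊Real.sqrt z⌋₊ ≤ N := by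
    have h1 : ⌊Real.sqrt z⌋₊ ≤ ⌊Real.sqrt z⌋₊ ^ 2 := Nat.le_self_pow two_ne_zero _
    have h2 : ((⌊Real.sqrt z⌋₊ ^ 2 : ℕ) : ℝ) ≤ N := by
      push_cast
      nlinarith
    exact h1.trans (by exact_mod_cast h2)
  have m₁ := abs_mean_sq_sub_fourierTrunc_le (H := H) hX hH.le (hD.trans hzX) hN
  have m₂ := abs_mean_fourierTrunc_sq_sub_diag_le pX H ⌊Real.sqrt z⌋₊ N
  have m₃ := abs_fourierDiag_sub_diagMain_le hH z hN1
  have m₃' : 4 * (⌊Real.sqrt z⌋₊ : ℝ) ^ 2 / N ≤ 4 := by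
    rw [div_le_iff₀ pN]; nlinarith
  have b₁ := sum_oscBound_sub_le pX hH.le hDN
  have b₂ := sum_inv_freq_add_le pX hH.le ⌊Real.sqrt z⌋₊ N
  set E₁ := ∑ p ∈ Finset.Icc 1 ⌊Real.sqrt z⌋₊ ×ˢ Finset.Icc 1 N,
    ∑ q ∈ Finset.Icc 1 ⌊Real.sqrt z⌋₊ ×ˢ Finset.Icc 1 N,
        |sawCoeff H p.1 p.2| * |sawCoeff H q.1 q.2| * oscBound X (freq p - freq q)
  set E₂ := ∑ p ∈ Finset.Icc 1 ⌊Real.sqrt z⌋₊ ×ˢ Finset.Icc 1 N,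
    ∑ q ∈ Finset.Icc 1 ⌊Real.sqrt z⌋₊ ×ˢ Finset.Icc 1 N,
        |sawCoeff H p.1 p.2| * |sawCoeff H q.1 q.2| * (1 / (X * (freq p + freq q)))
  set L := 1 + Real.log X with hL
  have hlogX : 0 ≤ Real.log X := Real.log_nonneg hX
  have hL1 : 1 ≤ L := by linarith
  have hlogN0 : 0 ≤ Real.log (N : ℝ) := Real.log_natCast_nonneg _
  have hlogN' : Real.log (N : ℝ) ≤ Real.log 2 + 2 * Real.log X := by
    have := Real.log_le_log pN hN2
    rwa [Real.log_mul (by norm_num) (by positivity), Real.log_pow, Nat.cast_ofNat] at this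
  have hlog2 := Real.log_two_lt_d9
  have hlogN : 1 + Real.log (N : ℝ) ≤ 2 * L := by linarith
  have hlogN3 : 1 + Real.log ((2 * N ^ 3 : ℕ) : ℝ) ≤ 6 * L := by
    push_cast
    rw [Real.log_mul (by norm_num) (by positivity), Real.log_pow, Nat.cast_ofNat]
    linarith
  have hlogN30 : 0 ≤ 1 + Real.log ((2 * N ^ 3 : ℕ) : ℝ) := by
    have : 0 ≤ Real.log ((2 * N ^ 3 : ℕ) : ℝ) := Real.log_natCast_nonneg _
    linarith
  set A := z / Real.sqrt X with hA
  set B := H * z / X with hB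
  have hA0 : 0 ≤ A := by positivity
  have hB0 : 0 ≤ B := by positivity
  have hDA : (⌊Real.sqrt z⌋₊ : ℝ) ^ 2 / Real.sqrt X ≤ A :=
    div_le_div_of_nonneg_right hD (Real.sqrt_nonneg _)
  have hDB : H * (⌊Real.sqrt z⌋₊ : ℝ) ^ 2 / X ≤ B :=
    div_le_div_of_nonneg_right (mul_le_mul_of_nonneg_left hD hH.le) pX.le
  have c₁ : E₁ ≤ (2 * L) ^ 2 * (2 * ((2 * L) * (A + B * (6 * L)))) := by
    refine b₁.trans ?_
    gcongr
  have c₂ : E₂ ≤ (2 * L) ^ 2 * B := by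
    refine b₂.trans ?_
    gcongr
  have l₃ : L ^ 3 ≤ L ^ 4 := pow_le_pow_right₀ hL1 (by norm_num)
  have l₂ : L ^ 2 ≤ L ^ 4 := pow_le_pow_right₀ hL1 (by norm_num)
  have c₃ : 2 * (E₁ + E₂) ≤ 200 * L ^ 4 * (A + B) := by
    have d₁ : L ^ 3 * A ≤ L ^ 4 * A := mul_le_mul_of_nonneg_right l₃ hA0
    have d₂ : L ^ 2 * B ≤ L ^ 4 * B := mul_le_mul_of_nonneg_right l₂ hB0
    have d₃ : 0 ≤ L ^ 4 * A := by positivity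
    nlinarith
  rw [abs_le] at m₁ m₂ m₃ ⊢
  constructor <;> linarith [m₁.1, m₁.2, m₂.1, m₂.2, m₃.1, m₃.2]

theorem one_add_log_pow_four_le {X ε : ℝ} (hX : 1 ≤ X) (hε : 0 < ε) :
    (1 + Real.log X) ^ 4 ≤ (1 + 6 / ε ^ 2) ^ 4 * (X ^ ε) ^ (2 * ε / 3) := by
  have pX : 0 < X := by linarith
  have hδ : 0 < ε ^ 2 / 6 := by positivity
  have h1 := Real.log_le_rpow_div pX.le hδ
  have h2 := Real.one_le_rpow hX hδ.le
  have h3 : 1 + Real.log X ≤ (1 + 6 / ε ^ 2) * X ^ (ε ^ 2 / 6) := by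
    have : X ^ (ε ^ 2 / 6) / (ε ^ 2 / 6) = 6 / ε ^ 2 * X ^ (ε ^ 2 / 6) := by field_simp
    linarith
  have h0 : 0 ≤ 1 + Real.log X := by linarith [Real.log_nonneg hX]
  calc _ ≤ ((1 + 6 / ε ^ 2) * X ^ (ε ^ 2 / 6)) ^ 4 := pow_le_pow_left₀ h0 h3 4
    _ = _ := by
      rw [mul_pow, ← Real.rpow_mul_natCast pX.le, ← Real.rpow_mul pX.le]
      congr 2
      push_cast
      ring

theorem small_divisors_smoothed_asymptotic :
    ∀ ε : ℝ, ε ∈ Set.Ioo (0 : ℝ) (1 / 100) →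
      ∃ K : ℝ, 0 < K ∧
        ∀ X H z : ℝ, 1 ≤ X → X ^ ε ≤ H → H ≤ X ^ ((2 : ℝ) / 3 - ε) →
          H ^ (1 + ε) ≤ z →
          z ≤ min (X ^ (1 - ε : ℝ) / H ^ ((1 : ℝ) / 2)) (H ^ ((1 : ℝ) / 2 - ε) * X ^ ((1 : ℝ) / 2)) →
            |(1 / X) * (∫ x in X..(2 * X), |pairShortCount x H z - H * mertensTrunc z| ^ 2)
                - diagMain H z|
              ≤ K * (H ^ (-(ε / 2)) * diagMain H z + H ^ ((1 : ℝ) / 2 - ε / 3)) := by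
  rintro ε ⟨hε, hε'⟩
  refine ⟨21 + 400 * (1 + 6 / ε ^ 2) ^ 4, by positivity, ?_⟩
  intro X H z hX hXH hHX hHz hz
  have pX : 0 < X := by linarith
  have hH1 : 1 ≤ H := (Real.one_le_rpow hX hε.le).trans hXH
  have pH : 0 < H := by linarith
  have hHX1 : H ≤ X := by
    refine hHX.trans ?_
    conv_rhs => rw [← Real.rpow_one X]
    exact Real.rpow_le_rpow_of_exponent_le hX (by linarith)
  have hz0 : 0 ≤ z := (Real.rpow_nonneg pH.le _).trans hHz
  obtain ⟨hz₁, hz₂⟩ := le_min_iff.mp hz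
  have hHhalf : 1 ≤ H ^ ((1 : ℝ) / 2) := Real.one_le_rpow hH1 (by norm_num)
  have hzX : z ≤ X := by
    refine hz₁.trans ((div_le_self (Real.rpow_nonneg pX.le _) hHhalf).trans ?_)
    conv_rhs => rw [← Real.rpow_one X]
    exact Real.rpow_le_rpow_of_exponent_le hX (by linarith)
  have hA : z / Real.sqrt X ≤ H ^ ((1 : ℝ) / 2 - ε) := by
    rw [div_le_iff₀ (Real.sqrt_pos.mpr pX), Real.sqrt_eq_rpow]
    exact hz₂
  have hB : H * z / X ≤ H ^ ((1 : ℝ) / 2 - ε) := by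
    calc H * z / X ≤ H * (X ^ (1 - ε : ℝ) / H ^ ((1 : ℝ) / 2)) / X := by gcongr
      _ = H ^ ((1 : ℝ) / 2) * (X ^ ε)⁻¹ := by
          have e : H = H ^ ((1 : ℝ) / 2) * H ^ ((1 : ℝ) / 2) := by
            rw [← Real.rpow_add pH]; norm_num
          have : 0 < H ^ ((1 : ℝ) / 2) := by linarith
          have : 0 < X ^ ε := Real.rpow_pos_of_pos pX _
          rw [Real.rpow_sub pX, Real.rpow_one]
          nth_rewrite 1 [e]
          field_simp
      _ ≤ H ^ ((1 : ℝ) / 2) * (H ^ ε)⁻¹ := by gcongr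
      _ = _ := by rw [Real.rpow_sub pH, div_eq_mul_inv (H ^ ((1 : ℝ) / 2))]
  have hL := one_add_log_pow_four_le hX hε
  have hL' : (1 + Real.log X) ^ 4 ≤ (1 + 6 / ε ^ 2) ^ 4 * H ^ (2 * ε / 3) :=
    hL.trans (by gcongr)
  have hmain := abs_mean_sub_diagMain_le hX pH hz0 hzX
  have hone : 1 ≤ H ^ ((1 : ℝ) / 2 - ε / 3) := Real.one_le_rpow hH1 (by linarith)
  have hdiag : 0 ≤ H ^ (-(ε / 2)) * diagMain H z :=
    mul_nonneg (Real.rpow_nonneg pH.le _) (diagMain_nonneg pH z)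
  have hbd : 200 * (1 + Real.log X) ^ 4 * (z / Real.sqrt X + H * z / X) ≤
      400 * (1 + 6 / ε ^ 2) ^ 4 * H ^ ((1 : ℝ) / 2 - ε / 3) := by
    calc _ ≤ 200 * ((1 + 6 / ε ^ 2) ^ 4 * H ^ (2 * ε / 3)) *
          (H ^ ((1 : ℝ) / 2 - ε) + H ^ ((1 : ℝ) / 2 - ε)) := by gcongr
      _ = 400 * (1 + 6 / ε ^ 2) ^ 4 * (H ^ (2 * ε / 3) * H ^ ((1 : ℝ) / 2 - ε)) := by ring
      _ = _ := by
          rw [← Real.rpow_add pH]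
          congr 2
          ring
  have hK : 0 ≤ 21 + 400 * (1 + 6 / ε ^ 2) ^ 4 := by positivity
  calc _ ≤ 21 + 200 * (1 + Real.log X) ^ 4 * (z / Real.sqrt X + H * z / X) := hmain
    _ ≤ (21 + 400 * (1 + 6 / ε ^ 2) ^ 4) * H ^ ((1 : ℝ) / 2 - ε / 3) := by linarith
    _ ≤ _ := mul_le_mul_of_nonneg_left (by linarith) hK
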